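/- arXiv:1912.12226 — 4 statements merged into one kernel-verified Lean document; each statement's English description precedes it below -/
import Mathlib

section
/- Let u_1,…,u_N : ℝ → ℝ be univariate utility functions (strictly concave, strictly increasing) with u_j(0) = 0 satisfying the Inada conditions lim_{x→+∞} u_j(x)/x = 0 and lim_{x→−∞} u_j(x)/x = +∞, and let Λ : ℝ^N → ℝ be concave, increasing (not necessarily strictly) and bounded from above. Define U(x) := ∑_{j=1}^N u_j(x^j) + Λ(x) and Φ̂(x) := ∑_{j=1}^N Φ̂_j(x^j) with Φ̂_j(z) := −u_j(−z) for z ≥ 0. Then Φ̂ is a multivariate Orlicz function and U is a well controlled multivariate utility function (for every ε > 0 there is f(ε) ∈ ℝ with U(x) ≤ −Φ̂((x)⁻) + ε∑_j|x^j| + f(ε)). If, in addition, each u_j is differentiable on ℝ with liminf_{x→−∞} x u_j'(x)/u_j(x) > 1, then also liminf_{z→+∞} z Φ̂_j'(z)/Φ̂_j(z) > 1 and lim_{z→+∞} Φ̂_j(z)/z = +∞ for every j (Assumption A3). -/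
open MeasureTheory Filter
open scoped BigOperators ENNReal Classical

noncomputable section

namespace MSORTE

variable {Ω : Type*} [MeasurableSpace Ω]

/-- inner product on `ℝ^N` -/
def dot {N : ℕ} (x y : Fin N → ℝ) : ℝ := ∑ j, x j * y j

/-- convex conjugate `V(y) = sup_x (U(x) - ⟨x,y⟩)` -/
def conj {N : ℕ} (U : (Fin N → ℝ) → ℝ) (y : Fin N → ℝ) : ℝ :=
  sSup {r | ∃ x : Fin N → ℝ, r = U x - dot x y}

/-- componentwise negative part -/
def negPart {N : ℕ} (x : Fin N → ℝ) : Fin N → ℝ := fun j => max (-(x j)) 0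

/-- componentwise positive part -/
def posPart {N : ℕ} (x : Fin N → ℝ) : Fin N → ℝ := fun j => max (x j) 0

/-- multivariate utility function: strictly concave, strictly increasing componentwise -/
def MultiUtility {N : ℕ} (U : (Fin N → ℝ) → ℝ) : Prop :=
  StrictConcaveOn ℝ Set.univ U ∧ ∀ x y : Fin N → ℝ, x ≤ y → x ≠ y → U x < U y

/-- multivariate Orlicz function -/
def MultiOrlicz {N : ℕ} (Φ : (Fin N → ℝ) → ℝ) : Prop :=
  Φ 0 = 0 ∧ ConvexOn ℝ {x : Fin N → ℝ | 0 ≤ x} Φ ∧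
  ContinuousOn Φ {x : Fin N → ℝ | 0 ≤ x} ∧
  (∀ x y : Fin N → ℝ, 0 ≤ x → x ≤ y → Φ x ≤ Φ y) ∧
  ∃ A > (0:ℝ), ∃ B : ℝ, ∀ x : Fin N → ℝ, 0 ≤ x → A * (∑ j, x j) - B ≤ Φ x

/-- the Orlicz function associated to a multivariate utility: `Φ(x) = U(0) - U(-x)` -/
def UPhi {N : ℕ} (U : (Fin N → ℝ) → ℝ) : (Fin N → ℝ) → ℝ := fun x => U 0 - U (-x)

/-- `U` is well controlled by the multivariate Orlicz function `Φhat` and the function `f` -/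
def WellControlledBy {N : ℕ} (U Φhat : (Fin N → ℝ) → ℝ) (f : ℝ → ℝ) : Prop :=
  MultiOrlicz Φhat ∧
  ∀ ε > (0:ℝ), ∀ x : Fin N → ℝ,
    U x ≤ -Φhat (negPart x) + ε * (∑ j, |x j|) + f ε

/-- the multivariate Orlicz space `L^Φ` -/
def Lspace {N : ℕ} (ℙ : Measure Ω) (Φ : (Fin N → ℝ) → ℝ) : Set (Ω → Fin N → ℝ) :=
  {X | Measurable X ∧ ∃ lam > (0:ℝ), Integrable (fun ω => Φ (fun j => lam * |X ω j|)) ℙ}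

/-- the multivariate Orlicz heart `M^Φ` -/
def Mspace {N : ℕ} (ℙ : Measure Ω) (Φ : (Fin N → ℝ) → ℝ) : Set (Ω → Fin N → ℝ) :=
  {X | Measurable X ∧ ∀ lam > (0:ℝ), Integrable (fun ω => Φ (fun j => lam * |X ω j|)) ℙ}

/-- the Köthe dual `K_Φ` of `L^Φ` -/
def Kdual {N : ℕ} (ℙ : Measure Ω) (Φ : (Fin N → ℝ) → ℝ) : Set (Ω → Fin N → ℝ) :=
  {Z | Measurable Z ∧ ∀ X ∈ Lspace ℙ Φ, Integrable (fun ω => ∑ j, X ω j * Z ω j) ℙ}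

/-- `C_ℝ`: random vectors whose componentwise sum is a.s. a real constant -/
def CReal {N : ℕ} (ℙ : Measure Ω) : Set (Ω → Fin N → ℝ) :=
  {Y | Measurable Y ∧ ∃ c : ℝ, ∀ᵐ ω ∂ℙ, (∑ j, Y ω j) = c}

/-- Standing Assumption II on the feasible set `𝓑` (except `X ∈ M^Φ`) -/
structure IsFeasibleSet {N : ℕ} (ℙ : Measure Ω) (B : Set (Ω → Fin N → ℝ)) : Prop where
  subset_CReal : B ⊆ CReal ℙ
  zero_mem : (0 : Ω → Fin N → ℝ) ∈ B
  add_mem : ∀ Y ∈ B, ∀ Z ∈ B, Y + Z ∈ B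
  smul_mem : ∀ Y ∈ B, ∀ c : ℝ, 0 ≤ c → c • Y ∈ B
  closed_in_probability : ∀ (Ys : ℕ → Ω → Fin N → ℝ) (Y : Ω → Fin N → ℝ),
    (∀ n, Ys n ∈ B) → Measurable Y → TendstoInMeasure ℙ Ys atTop Y → Y ∈ B
  const_add_mem : ∀ Y ∈ B, ∀ a : Fin N → ℝ, (fun ω => a + Y ω) ∈ B

/-- `𝓑_A` -/
def BA {N : ℕ} (ℙ : Measure Ω) (B : Set (Ω → Fin N → ℝ)) (A : ℝ) : Set (Ω → Fin N → ℝ) :=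
  {Y | Y ∈ B ∧ ∀ᵐ ω ∂ℙ, (∑ j, Y ω j) ≤ A}

/-- vector of Radon-Nikodym densities of a vector of measures w.r.t. `ℙ` -/
def dens {N : ℕ} (ℙ : Measure Ω) (Q : Fin N → Measure Ω) : Ω → Fin N → ℝ :=
  fun ω j => ((Q j).rnDeriv ℙ ω).toReal

/-- the set `𝓠` of admissible vectors of probability measures -/
def QSet {N : ℕ} (ℙ : Measure Ω) (B : Set (Ω → Fin N → ℝ)) (Φ : (Fin N → ℝ) → ℝ) :
    Set (Fin N → Measure Ω) :=
  {Q | (∀ j, IsProbabilityMeasure (Q j)) ∧ (∀ j, Q j ≪ ℙ) ∧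
    dens ℙ Q ∈ Kdual ℙ Φ ∧
    ∀ Y ∈ BA ℙ B 0 ∩ Mspace ℙ Φ, (∑ j, ∫ ω, Y ω j ∂(Q j)) ≤ 0}

/-- the set `𝓠_{𝓑,V}` of vectors of probability measures with finite entropy -/
def QBV {N : ℕ} (ℙ : Measure Ω) (B : Set (Ω → Fin N → ℝ))
    (Φ V : (Fin N → ℝ) → ℝ) : Set (Fin N → Measure Ω) :=
  {Q | Q ∈ QSet ℙ B Φ ∧ ∃ lam > (0:ℝ),
    Integrable (fun ω => V (fun j => lam * dens ℙ Q ω j)) ℙ}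

/-- the set `𝓛 = ⋂_{Q ∈ 𝓠_{𝓑,V}} L¹(Q)` -/
def LSet {N : ℕ} (ℙ : Measure Ω) (B : Set (Ω → Fin N → ℝ))
    (Φ V : (Fin N → ℝ) → ℝ) : Set (Ω → Fin N → ℝ) :=
  {Y | Measurable Y ∧ ∀ Q ∈ QBV ℙ B Φ V, ∀ j, Integrable (fun ω => Y ω j) (Q j)}

/-- Assumption A1: `𝓑` is closed under truncation -/
def ClosedUnderTruncation {N : ℕ} (ℙ : Measure Ω) (B : Set (Ω → Fin N → ℝ)) : Prop :=
  ∀ Y ∈ B, ∃ (mY : ℕ) (cY : Fin N → ℝ),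
    (∀ᵐ ω ∂ℙ, (∑ j, Y ω j) = ∑ j, cY j) ∧
    ∀ m : ℕ, mY ≤ m →
      (fun ω => if ∀ j, |Y ω j| < (m:ℝ) then Y ω else cY) ∈ B

/-- expected utility `E_ℙ[U(W)]` -/
def expU {N : ℕ} (ℙ : Measure Ω) (U : (Fin N → ℝ) → ℝ) (W : Ω → Fin N → ℝ) : ℝ :=
  ∫ ω, U (W ω) ∂ℙ

/-- the dual objective `λ(∑ⱼ E_{Qʲ}[Xʲ] + A) + E_ℙ[V(λ dQ/dℙ)]` -/
def dualVal {N : ℕ} (ℙ : Measure Ω) (V : (Fin N → ℝ) → ℝ) (X : Ω → Fin N → ℝ)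
    (A : ℝ) (Q : Fin N → Measure Ω) (lam : ℝ) : ℝ :=
  lam * ((∑ j, ∫ ω, X ω j ∂(Q j)) + A) + ∫ ω, V (fun j => lam * dens ℙ Q ω j) ∂ℙ

/-- `(L^∞(ℙ))^N` -/
def Linfty {N : ℕ} (ℙ : Measure Ω) : Set (Ω → Fin N → ℝ) :=
  {Y | Measurable Y ∧ ∃ C : ℝ, ∀ᵐ ω ∂ℙ, ∀ j, |Y ω j| ≤ C}

/-- multivariate Systemic Optimal Risk Transfer Equilibrium with budget `A` -/
def IsMSORTE {N : ℕ} (ℙ : Measure Ω) (B : Set (Ω → Fin N → ℝ))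
    (U : (Fin N → ℝ) → ℝ) (X : Ω → Fin N → ℝ) (A : ℝ)
    (Y : Ω → Fin N → ℝ) (Q : Fin N → Measure Ω) (a : Fin N → ℝ) : Prop :=
  Y ∈ LSet ℙ B (UPhi U) (conj U) ∧ Q ∈ QBV ℙ B (UPhi U) (conj U) ∧
  (∑ j, a j) = A ∧
  (∀ Y' ∈ LSet ℙ B (UPhi U) (conj U), ∀ a' : Fin N → ℝ, (∑ j, a' j) = A →
    expU ℙ U (fun ω j => a' j + X ω j + Y' ω j - ∫ ω', Y' ω' j ∂(Q j)) ≤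
    expU ℙ U (fun ω j => a j + X ω j + Y ω j - ∫ ω', Y ω' j ∂(Q j))) ∧
  Y ∈ B ∧ (∀ᵐ ω ∂ℙ, (∑ j, Y ω j) = 0)


/-- a separable sum of strictly concave functions is strictly concave -/
theorem strictConcaveOn_sum_apply {ι : Type*} [Fintype ι] {u : ι → ℝ → ℝ}
    (hu : ∀ j, StrictConcaveOn ℝ Set.univ (u j)) :
    StrictConcaveOn ℝ Set.univ (fun x : ι → ℝ => ∑ j, u j (x j)) := by
  refine ⟨convex_univ, fun x _ y _ hxy a b ha hb hab => ?_⟩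
  obtain ⟨i, hi⟩ := Function.ne_iff.mp hxy
  simp only [Finset.smul_sum, ← Finset.sum_add_distrib]
  refine Finset.sum_lt_sum (fun j _ => ?_) ⟨i, Finset.mem_univ i, ?_⟩
  · exact (hu j).concaveOn.2 (Set.mem_univ _) (Set.mem_univ _) ha.le hb.le hab
  · exact (hu i).2 (Set.mem_univ _) (Set.mem_univ _) hi ha hb hab

theorem exists_sub_le_neg_apply_neg {v : ℝ → ℝ} (hv : Monotone v) (hv0 : v 0 = 0)
    (hbot : Tendsto (fun x => v x / x) atBot atTop) :
    ∃ B : ℝ, ∀ z, 0 ≤ z → z - B ≤ -(v (-z)) := by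
  obtain ⟨m, hm⟩ := eventually_atBot.mp (hbot.eventually_ge_atTop 1)
  refine ⟨max (-m) 0, fun z hz => ?_⟩
  have hneg : v (-z) ≤ 0 := hv0 ▸ hv (by linarith : -z ≤ 0)
  rcases le_or_gt z (max (-m) 0) with h | h
  · linarith
  · have hz0 : -z < 0 := by linarith [le_max_right (-m) 0]
    have h1 := hm (-z) (by linarith [le_max_left (-m) 0])
    rw [le_div_iff_of_neg hz0] at h1
    linarith [le_max_right (-m) 0]

theorem exists_apply_le_mul_add {v : ℝ → ℝ} (hv : Monotone v) (hv0 : v 0 = 0)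
    (htop : Tendsto (fun x => v x / x) atTop (nhds 0)) {ε : ℝ} (hε : 0 < ε) :
    ∃ C : ℝ, ∀ x, v x ≤ v (-max (-x) 0) + ε * |x| + C := by
  obtain ⟨m, hm⟩ := eventually_atTop.mp (htop.eventually_le_const hε)
  have hC : 0 ≤ v (max m 0) := hv0.ge.trans (hv (le_max_right m 0))
  refine ⟨v (max m 0), fun x => ?_⟩
  have hεx : 0 ≤ ε * |x| := by positivity
  rcases le_or_gt x 0 with hx | hx
  · rw [max_eq_left (by linarith), neg_neg]
    linarith
  · rw [max_eq_right (by linarith), neg_zero, hv0, zero_add]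
    rcases le_or_gt x (max m 0) with h | h
    · linarith [hv h]
    · have h1 := hm x ((le_max_left m 0).trans h.le)
      rw [div_le_iff₀ hx] at h1
      rw [abs_of_pos hx]
      linarith

theorem multiOrlicz_sum_neg_apply_neg {N : ℕ} {u : Fin N → ℝ → ℝ}
    (huconc : ∀ j, ConcaveOn ℝ Set.univ (u j)) (humono : ∀ j, Monotone (u j))
    (hu0 : ∀ j, u j 0 = 0)
    (hbot : ∀ j, Tendsto (fun x => u j x / x) atBot atTop) :
    MultiOrlicz (fun x : Fin N → ℝ => ∑ j, -(u j (-(x j)))) := by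
  refine ⟨by simp [hu0], ⟨convex_Ici 0, fun x _ y _ a b ha hb hab => ?_⟩, ?_,
    fun x y _ hxy => ?_, ?_⟩
  · simp only [Finset.smul_sum, ← Finset.sum_add_distrib]
    refine Finset.sum_le_sum fun j _ => ?_
    have h := (huconc j).2 (Set.mem_univ (-(x j))) (Set.mem_univ (-(y j))) ha hb hab
    have he : -((a • x + b • y) j) = a • -(x j) + b • -(y j) := by
      simp only [Pi.add_apply, Pi.smul_apply, smul_eq_mul]
      ring
    rw [he]
    simp only [smul_eq_mul] at h ⊢
    linarith
  · have hc : ∀ j, Continuous (u j) := fun j =>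
      continuousOn_univ.mp ((huconc j).continuousOn isOpen_univ)
    exact Continuous.continuousOn (by fun_prop)
  · exact Finset.sum_le_sum fun j _ => neg_le_neg (humono j (neg_le_neg (hxy j)))
  · choose B hB using fun j => exists_sub_le_neg_apply_neg (humono j) (hu0 j) (hbot j)
    refine ⟨1, one_pos, ∑ j, B j, fun x hx => ?_⟩
    rw [one_mul, ← Finset.sum_sub_distrib]
    exact Finset.sum_le_sum fun j _ => hB j (x j) (hx j)

theorem multiUtility_sum_add {N : ℕ} {u : Fin N → ℝ → ℝ} {Λ : (Fin N → ℝ) → ℝ}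
    (huconc : ∀ j, StrictConcaveOn ℝ Set.univ (u j)) (humono : ∀ j, StrictMono (u j))
    (hΛconc : ConcaveOn ℝ Set.univ Λ) (hΛmono : Monotone Λ) :
    MultiUtility (fun x => (∑ j, u j (x j)) + Λ x) := by
  refine ⟨(strictConcaveOn_sum_apply huconc).add_concaveOn hΛconc, fun x y hxy hne => ?_⟩
  obtain ⟨i, hi⟩ := Function.ne_iff.mp hne
  exact add_lt_add_of_lt_of_le
    (Finset.sum_lt_sum (fun j _ => (humono j).monotone (hxy j))
      ⟨i, Finset.mem_univ i, humono i (lt_of_le_of_ne (hxy i) hi)⟩) (hΛmono hxy)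

/-- Proposition 7.1: construction of well controlled multivariate utilities from
univariate utilities satisfying the Inada conditions, plus an aggregation term `Λ`
(Statement 13). -/
theorem construction_well_controlled
    {N : ℕ} (hN : 1 ≤ N)
    (u : Fin N → ℝ → ℝ)
    (huconc : ∀ j, StrictConcaveOn ℝ Set.univ (u j))
    (humono : ∀ j, StrictMono (u j))
    (hu0 : ∀ j, u j 0 = 0)
    (hInadaTop : ∀ j, Tendsto (fun x => u j x / x) atTop (nhds 0))
    (hInadaBot : ∀ j, Tendsto (fun x => u j x / x) atBot atTop)
    (Λ : (Fin N → ℝ) → ℝ)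
    (hΛconc : ConcaveOn ℝ Set.univ Λ)
    (hΛmono : Monotone Λ)
    (hΛbdd : BddAbove (Set.range Λ)) :
    let U : (Fin N → ℝ) → ℝ := fun x => (∑ j, u j (x j)) + Λ x
    let Φh : (Fin N → ℝ) → ℝ := fun x => ∑ j, -(u j (-(x j)))
    -- Φ̂ is a multivariate Orlicz function and U is well controlled by Φ̂
    (MultiOrlicz Φh ∧ MultiUtility U ∧ ∃ f : ℝ → ℝ, WellControlledBy U Φh f) ∧
    -- under asymptotic elasticity at -∞, Assumption A3 holds
    ((∀ j, Differentiable ℝ (u j)) →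
      (∀ j, (1:ℝ) < Filter.liminf (fun x => x * deriv (u j) x / u j x) atBot) →
      ∀ j : Fin N,
        ((1:ℝ) < Filter.liminf
          (fun z => z * deriv (fun t => -(u j (-t))) z / (-(u j (-z)))) atTop) ∧
        Tendsto (fun z => -(u j (-z)) / z) atTop atTop) := by
  intro U Φh
  have hOrlicz : MultiOrlicz Φh := multiOrlicz_sum_neg_apply_neg
    (fun j => (huconc j).concaveOn) (fun j => (humono j).monotone) hu0 hInadaBot
  refine ⟨⟨hOrlicz, multiUtility_sum_add huconc humono hΛconc hΛmono, ?_⟩,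
    fun _ hAE j => ⟨?_, ?_⟩⟩
  · obtain ⟨K, hK⟩ := hΛbdd
    choose C hC using fun (j : Fin N) (ε : Set.Ioi (0 : ℝ)) =>
      exists_apply_le_mul_add (humono j).monotone (hu0 j) (hInadaTop j) ε.2
    refine ⟨fun ε => if h : 0 < ε then (∑ j, C j ⟨ε, h⟩) + K else 0, hOrlicz,
      fun ε hε x => ?_⟩
    have hsum := Finset.sum_le_sum fun j (_ : j ∈ Finset.univ) => hC j ⟨ε, hε⟩ (x j)
    have hΛx : Λ x ≤ K := hK (Set.mem_range_self x)
    simp only [Finset.sum_add_distrib, ← Finset.mul_sum] at hsum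
    simp only [U, Φh, negPart, dif_pos (show 0 < ε from hε), Finset.sum_neg_distrib, neg_neg]
    linarith
  · convert hAE j using 1
    rw [← map_neg_atTop, liminf, liminf, map_map]
    congr 2
    funext z
    simp only [Function.comp_apply, deriv.fun_neg, deriv_comp_neg]
    rw [neg_neg, neg_mul, div_neg, neg_div]
  · refine ((hInadaBot j).comp tendsto_neg_atTop_atBot).congr fun z => ?_
    simp only [Function.comp_apply, div_neg, neg_div]

end MSORTE
end
end

section
/- Suppose the multivariate utility function U is well controlled, with controlling multivariate Orlicz function Φ̂ and function f. Then: (i) Φ(x) := U(0) − U(−x), x ∈ (ℝ₊)^N, is a multivariate Orlicz function; (ii) L^Φ ⊆ L^{Φ̂}; (iii) for every sufficiently small ε > 0 there is a constant b_ε with U(x) ≤ ε ∑_{j=1}^N (x^j)⁺ + b_ε for all x ∈ ℝ^N; (iv) there exist a > 0 and b ∈ ℝ such that U(x) ≤ a ∑_{j=1}^N (x^j)⁺ − 2a ∑_{j=1}^N (x^j)⁻ + b for all x ∈ ℝ^N. -/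
open MeasureTheory Filter
open scoped BigOperators ENNReal Classical

noncomputable section

namespace MSORTE

variable {Ω : Type*} [MeasurableSpace Ω]

/-- Splitting `|x j|` into positive and negative parts and using the linear lower bound of `Φhat`
turns the control inequality into a piecewise linear upper bound for `U`. -/
theorem WellControlledBy.exists_le_posPart_sub_negPart {N : ℕ} {U Φhat : (Fin N → ℝ) → ℝ}
    {f : ℝ → ℝ} (h : WellControlledBy U Φhat f) :
    ∃ A > (0:ℝ), ∃ B : ℝ, ∀ ε > (0:ℝ), ∀ x : Fin N → ℝ,
      U x ≤ ε * (∑ j, max (x j) 0) - (A - ε) * (∑ j, max (-(x j)) 0) + (B + f ε) := by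
  obtain ⟨⟨-, -, -, -, A, hA, B, hB⟩, hctrl⟩ := h
  refine ⟨A, hA, B, fun ε hε x => ?_⟩
  have hbound := hB (negPart x) fun j => le_max_right _ _
  have habs : ∑ j, |x j| = ∑ j, max (x j) 0 + ∑ j, max (-(x j)) 0 := by
    rw [← Finset.sum_add_distrib]
    refine Finset.sum_congr rfl fun j _ => ?_
    rcases le_total (x j) 0 with hx | hx
    · rw [abs_of_nonpos hx, max_eq_right hx, max_eq_left (neg_nonneg.2 hx), zero_add]
    · rw [abs_of_nonneg hx, max_eq_left hx, max_eq_right (neg_nonpos.2 hx), add_zero]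
  have hU := hctrl ε hε x
  rw [habs] at hU
  simp only [negPart] at hbound hU
  linarith

theorem MultiUtility.mono {N : ℕ} {U : (Fin N → ℝ) → ℝ} (hU : MultiUtility U) : Monotone U := by
  intro x y hxy
  rcases eq_or_ne x y with rfl | hne
  · exact le_rfl
  · exact (hU.2 x y hxy hne).le

theorem MultiUtility.continuous {N : ℕ} {U : (Fin N → ℝ) → ℝ} (hU : MultiUtility U) :
    Continuous U :=
  continuousOn_univ.1 (hU.1.concaveOn.continuousOn isOpen_univ)

/-- The upper bound on `U` along the negative orthant is a lower bound on `UPhi U`. -/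
theorem WellControlledBy.exists_le_UPhi {N : ℕ} {U Φhat : (Fin N → ℝ) → ℝ} {f : ℝ → ℝ}
    (h : WellControlledBy U Φhat f) :
    ∃ A > (0:ℝ), ∃ B : ℝ, ∀ x : Fin N → ℝ, 0 ≤ x → A * (∑ j, x j) - B ≤ UPhi U x := by
  obtain ⟨A, hA, B, hB⟩ := h.exists_le_posPart_sub_negPart
  refine ⟨A / 2, by positivity, B + f (A / 2) - U 0, fun x hx => ?_⟩
  have hle := hB (A / 2) (by positivity) (-x)
  have hpos : ∑ j, max ((-x) j) 0 = 0 :=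
    Finset.sum_eq_zero fun j _ => max_eq_right (neg_nonpos.2 (hx j))
  have hneg : ∑ j, max (-((-x) j)) 0 = ∑ j, x j :=
    Finset.sum_congr rfl fun j _ => by
      rw [Pi.neg_apply, neg_neg]
      exact max_eq_left (hx j)
  rw [hpos, hneg] at hle
  simp only [UPhi]
  linarith

theorem WellControlledBy.multiOrlicz_UPhi {N : ℕ} {U Φhat : (Fin N → ℝ) → ℝ} {f : ℝ → ℝ}
    (h : WellControlledBy U Φhat f) (hU : MultiUtility U) : MultiOrlicz (UPhi U) := by
  refine ⟨by simp [UPhi], ⟨convex_Ici (0 : Fin N → ℝ), ?_⟩, ?_, ?_, h.exists_le_UPhi⟩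
  · intro x _ y _ a b ha hb hab
    have hconc := hU.1.concaveOn.2 (Set.mem_univ (-x)) (Set.mem_univ (-y)) ha hb hab
    have hneg : -(a • x + b • y) = a • (-x) + b • (-y) := by
      simp only [smul_neg, neg_add]
    have hzero : U 0 = a * U 0 + b * U 0 := by rw [← add_mul, hab, one_mul]
    simp only [UPhi, smul_eq_mul, hneg] at hconc ⊢
    linarith
  · exact (continuous_const.sub (hU.continuous.comp continuous_neg)).continuousOn
  · intro x y _ hxy
    exact sub_le_sub_left (hU.mono (neg_le_neg hxy)) _

theorem MultiOrlicz.nonneg {N : ℕ} {Φ : (Fin N → ℝ) → ℝ} (hΦ : MultiOrlicz Φ)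
    {x : Fin N → ℝ} (hx : 0 ≤ x) : 0 ≤ Φ x :=
  hΦ.1.symm.le.trans (hΦ.2.2.2.1 0 x le_rfl hx)

/-- Absorbing the linear term of the control inequality gives `Φhat ≤ C • UPhi U + D` on the
positive orthant. -/
theorem WellControlledBy.exists_le_mul_UPhi_add {N : ℕ} {U Φhat : (Fin N → ℝ) → ℝ} {f : ℝ → ℝ}
    (h : WellControlledBy U Φhat f) :
    ∃ C D : ℝ, ∀ x : Fin N → ℝ, 0 ≤ x → Φhat x ≤ C * UPhi U x + D := by
  obtain ⟨A, hA, B, hB⟩ := h.exists_le_UPhi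
  refine ⟨2, B + f A - U 0, fun x hx => ?_⟩
  have hneg : negPart (-x) = x := by
    funext j
    simp only [negPart, Pi.neg_apply, neg_neg]
    exact max_eq_left (hx j)
  have habs : ∑ j, |(-x) j| = ∑ j, x j :=
    Finset.sum_congr rfl fun j _ => by rw [Pi.neg_apply, abs_neg, abs_of_nonneg (hx j)]
  have hctrl := h.2 A hA (-x)
  rw [hneg, habs] at hctrl
  have hlower := hB x hx
  simp only [UPhi] at hlower ⊢
  linarith

theorem Lspace_subset_of_le_mul_add {Ω : Type*} [MeasurableSpace Ω] (ℙ : Measure Ω)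
    [IsFiniteMeasure ℙ] {N : ℕ} {Φ Ψ : (Fin N → ℝ) → ℝ} (hΨ : MultiOrlicz Ψ) (C D : ℝ)
    (hle : ∀ x : Fin N → ℝ, 0 ≤ x → Ψ x ≤ C * Φ x + D) : Lspace ℙ Φ ⊆ Lspace ℙ Ψ := by
  rintro X ⟨hX, lam, hlam, hint⟩
  have hnonneg : ∀ x : Fin N → ℝ, 0 ≤ fun j => lam * |x j| := fun x j =>
    mul_nonneg hlam.le (abs_nonneg (x j))
  have hcont : Continuous fun x : Fin N → ℝ => Ψ fun j => lam * |x j| :=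
    hΨ.2.2.1.comp_continuous (by fun_prop) hnonneg
  refine ⟨hX, lam, hlam, ((hint.const_mul C).add (integrable_const D)).mono'
    (hcont.measurable.comp hX).aestronglyMeasurable (ae_of_all _ fun ω => ?_)⟩
  rw [Real.norm_of_nonneg (hΨ.nonneg (hnonneg (X ω)))]
  exact hle _ (hnonneg (X ω))

/-- Lemma 3.5: consequences of being well controlled (Statement 15). -/
theorem well_controlled_consequences
    {Ω : Type*} [MeasurableSpace Ω] (ℙ : Measure Ω) [IsProbabilityMeasure ℙ]
    {N : ℕ} (hN : 1 ≤ N)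
    (U Φhat : (Fin N → ℝ) → ℝ) (f : ℝ → ℝ)
    (hU : MultiUtility U) (hWC : WellControlledBy U Φhat f) :
    -- (i) Φ(x) = U(0) − U(−x) is a multivariate Orlicz function
    MultiOrlicz (UPhi U) ∧
    -- (ii) L^Φ ⊆ L^Φ̂
    Lspace ℙ (UPhi U) ⊆ Lspace ℙ Φhat ∧
    -- (iii) for every small enough ε > 0 there is b_ε with U(x) ≤ ε ∑ (xʲ)⁺ + b_ε
    (∃ ε₀ > (0:ℝ), ∀ ε : ℝ, 0 < ε → ε ≤ ε₀ → ∃ b : ℝ,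
      ∀ x : Fin N → ℝ, U x ≤ ε * (∑ j, max (x j) 0) + b) ∧
    -- (iv) there exist a > 0 and b with U(x) ≤ a ∑ (xʲ)⁺ − 2a ∑ (xʲ)⁻ + b
    (∃ a > (0:ℝ), ∃ b : ℝ, ∀ x : Fin N → ℝ,
      U x ≤ a * (∑ j, max (x j) 0) - 2 * a * (∑ j, max (-(x j)) 0) + b) := by
  refine ⟨hWC.multiOrlicz_UPhi hU, ?_, ?_, ?_⟩
  · obtain ⟨C, D, hCD⟩ := hWC.exists_le_mul_UPhi_add
    exact Lspace_subset_of_le_mul_add ℙ hWC.1 C D hCD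
  · obtain ⟨A, hA, B, hB⟩ := hWC.exists_le_posPart_sub_negPart
    refine ⟨A, hA, fun ε hε hεA => ⟨B + f ε, fun x => (hB ε hε x).trans ?_⟩⟩
    have hsum : 0 ≤ ∑ j, max (-(x j)) 0 := Finset.sum_nonneg fun j _ => le_max_right _ _
    linarith [mul_nonneg (sub_nonneg.2 hεA) hsum]
  · obtain ⟨A, hA, B, hB⟩ := hWC.exists_le_posPart_sub_negPart
    refine ⟨A / 3, by positivity, B + f (A / 3), fun x =>
      (hB (A / 3) (by positivity) x).trans_eq ?_⟩
    ring

end MSORTE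
end
end

section
/- Suppose Assumption A1 holds (𝓑 is closed under truncation). Then for every Y ∈ 𝓛 ∩ 𝓑_A and every Q ∈ 𝓠_{𝓑,V} it holds that ∑_{j=1}^N E_{Q^j}[Y^j] ≤ A. -/
open MeasureTheory Filter
open scoped BigOperators ENNReal Classical

noncomputable section

namespace MSORTE

variable {Ω : Type*} [MeasurableSpace Ω]

/-- Bounded random vectors belong to the Orlicz heart of a continuous function. -/
theorem mem_Mspace_of_bounded {Ω : Type*} [MeasurableSpace Ω] {ℙ : Measure Ω}
    [IsFiniteMeasure ℙ] {N : ℕ} {Φ : (Fin N → ℝ) → ℝ} (hΦ : Continuous Φ)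
    {X : Ω → Fin N → ℝ} (hX : Measurable X) {C : ℝ} (hC : ∀ ω j, |X ω j| ≤ C) :
    X ∈ Mspace ℙ Φ := by
  refine ⟨hX, fun lam hlam => ?_⟩
  obtain ⟨K, hK⟩ := (isCompact_univ_pi fun _ : Fin N =>
    isCompact_Icc (a := 0) (b := lam * C)).exists_bound_of_continuousOn hΦ.continuousOn
  have hmeas : Measurable fun ω => Φ fun j => lam * |X ω j| :=
    hΦ.measurable.comp <| measurable_pi_lambda _ fun j =>
      ((measurable_pi_apply j).comp hX).abs.const_mul lam
  refine Integrable.of_bound hmeas.aestronglyMeasurable K (.of_forall fun ω => hK _ ?_)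
  exact fun j _ => ⟨by positivity, mul_le_mul_of_nonneg_left (hC ω j) hlam.le⟩

/-- The truncation of `Y` at level `m`, equal to `c` where some component is not below `m`. -/
def truncation {Ω : Type*} {N : ℕ} (Y : Ω → Fin N → ℝ) (c : Fin N → ℝ) (m : ℕ) :
    Ω → Fin N → ℝ :=
  fun ω => if ∀ j, |Y ω j| < (m : ℝ) then Y ω else c

theorem tendsto_truncation {Ω : Type*} {N : ℕ} (Y : Ω → Fin N → ℝ) (c : Fin N → ℝ)
    (ω : Ω) (j : Fin N) :
    Tendsto (fun m => truncation Y c m ω j) atTop (nhds (Y ω j)) := by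
  have hev : ∀ᶠ m : ℕ in atTop, ∀ j, |Y ω j| < (m : ℝ) :=
    eventually_all.mpr fun j => tendsto_natCast_atTop_atTop.eventually_gt_atTop _
  refine tendsto_const_nhds.congr' ?_
  filter_upwards [hev] with m hm
  rw [truncation, if_pos hm]

theorem abs_truncation_le_add {Ω : Type*} {N : ℕ} (Y : Ω → Fin N → ℝ) (c : Fin N → ℝ)
    (m : ℕ) (ω : Ω) (j : Fin N) : |truncation Y c m ω j| ≤ |Y ω j| + |c j| := by
  unfold truncation
  split_ifs <;> simp

theorem abs_truncation_le {Ω : Type*} {N : ℕ} (Y : Ω → Fin N → ℝ) (c : Fin N → ℝ)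
    (m : ℕ) (ω : Ω) (j : Fin N) : |truncation Y c m ω j| ≤ m + ∑ i, |c i| := by
  have hc : |c j| ≤ ∑ i, |c i| :=
    Finset.single_le_sum (f := fun i => |c i|) (fun i _ => abs_nonneg _) (Finset.mem_univ j)
  have hm : (0 : ℝ) ≤ m := m.cast_nonneg
  unfold truncation
  split_ifs with h
  · linarith [h j, abs_nonneg (c j)]
  · linarith

/-- The components of an element of `𝓑` with constant sum `∑ⱼ cⱼ` that lies in a bounded set have
`Q`-expectations summing to at most `∑ⱼ cⱼ`. -/
theorem sum_integral_le_of_bounded {Ω : Type*} [MeasurableSpace Ω] {ℙ : Measure Ω}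
    [IsFiniteMeasure ℙ] {N : ℕ} {Φ : (Fin N → ℝ) → ℝ} (hΦ : Continuous Φ)
    {B : Set (Ω → Fin N → ℝ)} (hB : IsFeasibleSet ℙ B) {Q : Fin N → Measure Ω}
    (hQ : Q ∈ QSet ℙ B Φ) {Z : Ω → Fin N → ℝ} (hZ : Z ∈ B) {C : ℝ}
    (hC : ∀ ω j, |Z ω j| ≤ C) (c : Fin N → ℝ) (hc : ∀ᵐ ω ∂ℙ, ∑ j, Z ω j = ∑ j, c j) :
    ∑ j, ∫ ω, Z ω j ∂(Q j) ≤ ∑ j, c j := by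
  obtain ⟨hprob, -, -, hfair⟩ := hQ
  have hZm : Measurable Z := (hB.subset_CReal hZ).1
  have hint : ∀ j, Integrable (fun ω => Z ω j) (Q j) := fun j =>
    Integrable.of_bound ((measurable_pi_apply j).comp hZm).aestronglyMeasurable C
      (.of_forall fun ω => hC ω j)
  have hmem : (fun ω => -c + Z ω) ∈ BA ℙ B 0 ∩ Mspace ℙ Φ := by
    refine ⟨⟨hB.const_add_mem Z hZ (-c), ?_⟩, ?_⟩
    · filter_upwards [hc] with ω hω
      simp [Finset.sum_add_distrib, hω]
    · refine mem_Mspace_of_bounded hΦ (hZm.const_add _) (C := (∑ i, |c i|) + C)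
        fun ω j => ?_
      have hcj : |c j| ≤ ∑ i, |c i| :=
        Finset.single_le_sum (f := fun i => |c i|) (fun i _ => abs_nonneg _) (Finset.mem_univ j)
      calc |(-c + Z ω) j| ≤ |(-c) j| + |Z ω j| := abs_add_le _ _
        _ ≤ (∑ i, |c i|) + C := add_le_add (by simpa using hcj) (hC ω j)
  have key : ∑ j, ∫ ω, (-c + Z ω) j ∂(Q j) = -∑ j, c j + ∑ j, ∫ ω, Z ω j ∂(Q j) := by
    rw [← Finset.sum_neg_distrib, ← Finset.sum_add_distrib]
    refine Finset.sum_congr rfl fun j _ => ?_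
    simp only [Pi.add_apply, Pi.neg_apply]
    rw [integral_add (integrable_const _) (hint j)]
    simp
  linarith [hfair _ hmem]

/-- Lemma A.1: under closedness under truncation, for `Y ∈ 𝓛 ∩ 𝓑_A` and
`Q ∈ 𝓠_{𝓑,V}` one has `∑ⱼ E_{Qʲ}[Yʲ] ≤ A` (Statement 16). -/
theorem fairness_general
    {Ω : Type*} [MeasurableSpace Ω] (ℙ : Measure Ω) [IsProbabilityMeasure ℙ]
    {N : ℕ} (hN : 1 ≤ N)
    (U Φhat : (Fin N → ℝ) → ℝ) (f : ℝ → ℝ)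
    (hU : MultiUtility U) (hWC : WellControlledBy U Φhat f)
    (hLL : Lspace ℙ Φhat = Lspace ℙ (UPhi U))
    (B : Set (Ω → Fin N → ℝ)) (hB : IsFeasibleSet ℙ B)
    (hA1 : ClosedUnderTruncation ℙ B) (A : ℝ) :
    ∀ Y ∈ LSet ℙ B (UPhi U) (conj U) ∩ BA ℙ B A,
      ∀ Q ∈ QBV ℙ B (UPhi U) (conj U),
        (∑ j, ∫ ω, Y ω j ∂(Q j)) ≤ A := by
  rintro Y ⟨⟨-, hYint⟩, hYB, hYA⟩ Q hQ
  obtain ⟨mY, c, hsum, htrunc⟩ := hA1 Y hYB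
  have hcA : ∑ j, c j ≤ A := by
    obtain ⟨ω, hω, hωA⟩ := (hsum.and hYA).exists
    exact hω ▸ hωA
  have hΦ : Continuous (UPhi U) := continuous_const.sub (hU.continuous.comp continuous_neg)
  have hprob := hQ.1.1
  have hlim : Tendsto (fun m => ∑ j, ∫ ω, truncation Y c (m + mY) ω j ∂(Q j)) atTop
      (nhds (∑ j, ∫ ω, Y ω j ∂(Q j))) := by
    refine tendsto_finsetSum _ fun j _ => ?_
    refine tendsto_integral_of_dominated_convergence (fun ω => |Y ω j| + |c j|) (fun m => ?_)
      ((hYint Q hQ j).abs.add (integrable_const _)) (fun m => ?_) ?_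
    · exact ((measurable_pi_apply j).comp
        (hB.subset_CReal (htrunc _ (Nat.le_add_left mY m))).1).aestronglyMeasurable
    · exact .of_forall fun ω => abs_truncation_le_add Y c _ ω j
    · exact .of_forall fun ω =>
        (tendsto_truncation Y c ω j).comp (tendsto_add_atTop_nat mY)
  refine le_trans (le_of_tendsto' hlim fun m => ?_) hcA
  refine sum_integral_le_of_bounded hΦ hB hQ.1 (htrunc _ (Nat.le_add_left mY m))
    (abs_truncation_le Y c (m + mY)) c ?_
  filter_upwards [hsum] with ω hω
  split_ifs
  · exact hω
  · rfl

end MSORTE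
end
end

section
/- Let Φ be a multivariate Orlicz function. Then the topological dual of the Orlicz heart M^Φ, endowed with the Luxemburg norm ‖·‖_Φ, is (isometrically) the Köthe dual K_Φ endowed with the dual norm ‖Z‖*_Φ := sup{E_ℙ[|∑_{j=1}^N X^j Z^j|] : ‖X‖_Φ ≤ 1}; moreover K_Φ = {Z : ∑_{j=1}^N X^j Z^j ∈ L¹(ℙ) for all X ∈ M^Φ}, and K_Φ ⊆ (L¹(ℙ))^N. -/
open MeasureTheory Filter
open scoped BigOperators ENNReal Classical

noncomputable section

namespace MSORTE

variable {Ω : Type*} [MeasurableSpace Ω]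

namespace MultiOrlicz

variable {N : ℕ} {Φ : (Fin N → ℝ) → ℝ}

lemma mono (h : MultiOrlicz Φ) {x y : Fin N → ℝ} (hx : 0 ≤ x) (hxy : x ≤ y) : Φ x ≤ Φ y :=
  h.2.2.2.1 x y hx hxy

lemma nonneg_s19 (h : MultiOrlicz Φ) {x : Fin N → ℝ} (hx : 0 ≤ x) : 0 ≤ Φ x :=
  h.1 ▸ h.mono le_rfl hx

lemma map_smul_le (h : MultiOrlicz Φ) {t : ℝ} (ht : 0 ≤ t) (ht1 : t ≤ 1) {x : Fin N → ℝ}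
    (hx : 0 ≤ x) : Φ (t • x) ≤ t * Φ x := by
  have := h.2.1.2 (x := x) (y := 0) hx (le_refl (0 : Fin N → ℝ)) ht (sub_nonneg.2 ht1)
    (by ring)
  simpa [h.1] using this

lemma measurable_comp (h : MultiOrlicz Φ) {Y : Ω → Fin N → ℝ} (hY : Measurable Y)
    (h0 : ∀ ω, 0 ≤ Y ω) : Measurable fun ω => Φ (Y ω) := by
  have hc : Continuous fun x : Fin N → ℝ => Φ fun j => max (x j) 0 :=
    h.2.2.1.comp_continuous (by fun_prop) fun x j => le_max_right _ _
  convert hc.measurable.comp hY using 2 with ω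
  exact congrArg Φ (funext fun j => (max_eq_left (h0 ω j)).symm)

lemma integrable_of_le (h : MultiOrlicz Φ) {ℙ : Measure Ω} {Y W : Ω → Fin N → ℝ}
    (hY : Integrable (fun ω => Φ (Y ω)) ℙ) (hW : Measurable W) (h0 : ∀ ω, 0 ≤ W ω)
    (hle : ∀ ω, W ω ≤ Y ω) : Integrable (fun ω => Φ (W ω)) ℙ :=
  hY.mono' (h.measurable_comp hW h0).aestronglyMeasurable <| ae_of_all _ fun ω => by
    rw [Real.norm_of_nonneg (h.nonneg_s19 (h0 ω))]
    exact h.mono (h0 ω) (hle ω)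

end MultiOrlicz

section Heart

variable {N : ℕ} {Φ : (Fin N → ℝ) → ℝ} {ℙ : Measure Ω} {X Y : Ω → Fin N → ℝ}

lemma measurable_mul_abs (hX : Measurable X) (c : ℝ) :
    Measurable fun ω j => c * |X ω j| := by
  refine measurable_pi_lambda _ fun j => ?_
  have := (measurable_pi_apply j).comp hX
  exact (this.abs).const_mul c

lemma mul_abs_nonneg {c : ℝ} (hc : 0 ≤ c) (x : Fin N → ℝ) : 0 ≤ fun j => c * |x j| :=
  fun _ => mul_nonneg hc (abs_nonneg _)

lemma Mspace_subset_Lspace : Mspace ℙ Φ ⊆ Lspace ℙ Φ :=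
  fun _ hX => ⟨hX.1, 1, one_pos, hX.2 1 one_pos⟩

lemma mem_Mspace_of_abs_le (hΦ : MultiOrlicz Φ) (hX : X ∈ Mspace ℙ Φ) (hY : Measurable Y)
    (hle : ∀ ω j, |Y ω j| ≤ |X ω j|) : Y ∈ Mspace ℙ Φ :=
  ⟨hY, fun lam hl => hΦ.integrable_of_le (hX.2 lam hl) (measurable_mul_abs hY lam)
    (fun _ => mul_abs_nonneg hl.le _) fun ω j => by have := hle ω j; dsimp only; gcongr⟩

lemma mem_Mspace_of_bounded_s19 [IsFiniteMeasure ℙ] (hΦ : MultiOrlicz Φ) (hY : Measurable Y) {K : ℝ}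
    (hK : ∀ ω j, |Y ω j| ≤ K) : Y ∈ Mspace ℙ Φ :=
  ⟨hY, fun lam hl => hΦ.integrable_of_le (Y := fun _ _ => lam * K) (integrable_const _)
    (measurable_mul_abs hY lam) (fun _ => mul_abs_nonneg hl.le _)
    fun ω j => by have := hK ω j; dsimp only; gcongr⟩

lemma zero_mem_Mspace [IsFiniteMeasure ℙ] (hΦ : MultiOrlicz Φ) :
    (0 : Ω → Fin N → ℝ) ∈ Mspace ℙ Φ :=
  mem_Mspace_of_bounded_s19 hΦ measurable_const (K := 0) (by simp)

lemma smul_mem_Mspace (hΦ : MultiOrlicz Φ) (hX : X ∈ Mspace ℙ Φ) (c : ℝ) :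
    c • X ∈ Mspace ℙ Φ := by
  refine ⟨hX.1.const_smul c, fun lam hl => ?_⟩
  refine hΦ.integrable_of_le (hX.2 (lam * (|c| + 1)) (by positivity))
    (measurable_mul_abs (hX.1.const_smul c) lam) (fun _ => mul_abs_nonneg hl.le _) fun ω j => ?_
  simp only [Pi.smul_apply, smul_eq_mul, abs_mul, mul_assoc]
  have := abs_nonneg (X ω j)
  gcongr
  linarith

lemma add_mem_Mspace (hΦ : MultiOrlicz Φ) (hX : X ∈ Mspace ℙ Φ) (hY : Y ∈ Mspace ℙ Φ) :
    X + Y ∈ Mspace ℙ Φ := by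
  refine ⟨hX.1.add hY.1, fun lam hl => ?_⟩
  have hm := measurable_mul_abs (hX.1.add hY.1) lam
  have h0 := fun ω => mul_abs_nonneg hl.le ((X + Y) ω)
  refine (((hX.2 (2 * lam) (by positivity)).const_mul (1 / 2)).add
    ((hY.2 (2 * lam) (by positivity)).const_mul (1 / 2))).mono'
    (hΦ.measurable_comp hm h0).aestronglyMeasurable <| ae_of_all _ fun ω => ?_
  rw [Real.norm_of_nonneg (hΦ.nonneg_s19 (h0 ω))]
  have hconv := hΦ.2.1.2 (x := fun j => 2 * lam * |X ω j|) (y := fun j => 2 * lam * |Y ω j|)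
    (mul_abs_nonneg (by positivity) _) (mul_abs_nonneg (by positivity) _)
    (by norm_num : (0 : ℝ) ≤ 1 / 2) (by norm_num : (0 : ℝ) ≤ 1 / 2) (by norm_num)
  refine (hΦ.mono (h0 ω) fun j => ?_).trans hconv
  have := mul_le_mul_of_nonneg_left (abs_add_le (X ω j) (Y ω j)) hl.le
  simp only [Pi.add_apply, Pi.smul_apply, smul_eq_mul]
  linarith

/-- The Orlicz heart as a subspace of the space of random vectors. -/
def heart (ℙ : Measure Ω) [IsFiniteMeasure ℙ] (hΦ : MultiOrlicz Φ) :
    Submodule ℝ (Ω → Fin N → ℝ) where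
  carrier := Mspace ℙ Φ
  add_mem' := add_mem_Mspace hΦ
  zero_mem' := zero_mem_Mspace hΦ
  smul_mem' c _ hX := smul_mem_Mspace hΦ hX c

/-- The Luxemburg norm. -/
def lux (ℙ : Measure Ω) (Φ : (Fin N → ℝ) → ℝ) (X : Ω → Fin N → ℝ) : ℝ :=
  sInf {lam : ℝ | 0 < lam ∧ Integrable (fun ω => Φ (fun j => |X ω j| / lam)) ℙ ∧
    (∫ ω, Φ (fun j => |X ω j| / lam) ∂ℙ) ≤ 1}

/-- `IsLuxBound ℙ Φ X c` says that `c` is one of the constants over which the infimum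
defining the Luxemburg norm of `X` is taken. -/
def IsLuxBound (ℙ : Measure Ω) (Φ : (Fin N → ℝ) → ℝ) (X : Ω → Fin N → ℝ) (c : ℝ) : Prop :=
  0 < c ∧ Integrable (fun ω => Φ (fun j => |X ω j| / c)) ℙ ∧
    (∫ ω, Φ (fun j => |X ω j| / c) ∂ℙ) ≤ 1

lemma lux_nonneg : 0 ≤ lux ℙ Φ X := Real.sInf_nonneg fun _ h => h.1.le

lemma IsLuxBound.lux_le {c : ℝ} (h : IsLuxBound ℙ Φ X c) : lux ℙ Φ X ≤ c :=
  csInf_le ⟨0, fun _ h => h.1.le⟩ h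

lemma IsLuxBound.of_le (hΦ : MultiOrlicz Φ) {b c : ℝ} (h : IsLuxBound ℙ Φ X b) (hbc : b ≤ c)
    (hY : Measurable Y) (hle : ∀ ω j, |Y ω j| ≤ |X ω j|) : IsLuxBound ℙ Φ Y c := by
  have hb := h.1
  have hc : 0 < c := hb.trans_le hbc
  have hm : Measurable fun ω j => |Y ω j| / c := by
    simpa only [div_eq_inv_mul] using measurable_mul_abs hY c⁻¹
  have h0 : ∀ ω, 0 ≤ fun j => |Y ω j| / c := fun ω j => by positivity
  have hl : ∀ ω, (fun j => |Y ω j| / c) ≤ fun j => |X ω j| / b := fun ω j => by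
    have := hle ω j
    dsimp only
    gcongr
  have hi := hΦ.integrable_of_le h.2.1 hm h0 hl
  exact ⟨hc, hi, (integral_mono hi h.2.1 fun ω => hΦ.mono (h0 ω) (hl ω)).trans h.2.2⟩

lemma IsLuxBound.inv_smul {c : ℝ} (h : IsLuxBound ℙ Φ X c) : IsLuxBound ℙ Φ (c⁻¹ • X) 1 := by
  have : ∀ ω, (fun j => |(c⁻¹ • X) ω j| / 1) = fun j => |X ω j| / c := fun ω => by
    ext j
    simp [abs_mul, abs_of_pos h.1, div_eq_inv_mul]
  refine ⟨one_pos, ?_, ?_⟩ <;> simp only [this]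
  exacts [h.2.1, h.2.2]

lemma exists_isLuxBound (hΦ : MultiOrlicz Φ) (hX : X ∈ Lspace ℙ Φ) : ∃ c, IsLuxBound ℙ Φ X c := by
  obtain ⟨hXm, lam, hl, hi⟩ := hX
  set I := ∫ ω, Φ (fun j => lam * |X ω j|) ∂ℙ
  have hI : 0 ≤ I := integral_nonneg fun ω => hΦ.nonneg_s19 (mul_abs_nonneg hl.le _)
  set t : ℝ := (I + 1)⁻¹
  have ht0 : 0 < t := by positivity
  have ht1 : t ≤ 1 := inv_le_one_of_one_le₀ (by linarith)
  have heq : ∀ ω, (fun j => |X ω j| / (lam * t)⁻¹) = t • fun j => lam * |X ω j| := fun ω => by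
    ext j
    simp only [div_inv_eq_mul, Pi.smul_apply, smul_eq_mul]
    ring
  have hle : ∀ ω, Φ (t • fun j => lam * |X ω j|) ≤ t * Φ (fun j => lam * |X ω j|) := fun ω =>
    hΦ.map_smul_le ht0.le ht1 (mul_abs_nonneg hl.le _)
  have h0 : ∀ ω, 0 ≤ t • fun j => lam * |X ω j| := fun ω =>
    smul_nonneg ht0.le (mul_abs_nonneg hl.le _)
  have hi' : Integrable (fun ω => Φ (t • fun j => lam * |X ω j|)) ℙ :=
    (hi.const_mul t).mono' (hΦ.measurable_comp ((measurable_mul_abs hXm lam).const_smul t)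
      h0).aestronglyMeasurable <| ae_of_all _ fun ω => by
        rw [Real.norm_of_nonneg (hΦ.nonneg_s19 (h0 ω))]
        exact hle ω
  refine ⟨(lam * t)⁻¹, by positivity, ?_, ?_⟩ <;> simp only [heq]
  · exact hi'
  · refine (integral_mono hi' (hi.const_mul t) hle).trans ?_
    rw [integral_const_mul]
    change (I + 1)⁻¹ * I ≤ 1
    rw [inv_mul_le_one₀ (by positivity)]
    linarith

lemma isLuxBound_of_lux_lt (hΦ : MultiOrlicz Φ) (hX : X ∈ Lspace ℙ Φ) {c : ℝ}
    (hc : lux ℙ Φ X < c) : IsLuxBound ℙ Φ X c := by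
  obtain ⟨b, hb, hbc⟩ := exists_lt_of_csInf_lt (exists_isLuxBound hΦ hX) hc
  exact IsLuxBound.of_le hΦ hb hbc.le hX.1 fun _ _ => le_rfl

lemma lux_le_of_abs_le (hΦ : MultiOrlicz Φ) (hX : X ∈ Lspace ℙ Φ) (hY : Measurable Y)
    (hle : ∀ ω j, |Y ω j| ≤ |X ω j|) : lux ℙ Φ Y ≤ lux ℙ Φ X :=
  le_of_forall_gt_imp_ge_of_dense fun _ hc =>
    ((isLuxBound_of_lux_lt hΦ hX hc).of_le hΦ le_rfl hY hle).lux_le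

/-- Order continuity of the Luxemburg norm on the Orlicz heart. -/
lemma tendsto_lux_zero (hΦ : MultiOrlicz Φ) (hX : X ∈ Mspace ℙ Φ) {ι : Type*} {l : Filter ι}
    [l.IsCountablyGenerated] {W : ι → Ω → Fin N → ℝ}
    (hW : ∀ n, Measurable (W n)) (hle : ∀ n ω j, |W n ω j| ≤ |X ω j|)
    (hlim : ∀ ω, Tendsto (fun n => W n ω) l (nhds 0)) :
    Tendsto (fun n => lux ℙ Φ (W n)) l (nhds 0) := by
  rw [Metric.tendsto_nhds]
  intro ε hε
  have hc : 0 < (ε / 2)⁻¹ := by positivity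
  have h0 : ∀ n ω, 0 ≤ fun j => (ε / 2)⁻¹ * |W n ω j| := fun n ω => mul_abs_nonneg hc.le _
  have hlW : ∀ n ω, (fun j => (ε / 2)⁻¹ * |W n ω j|) ≤ fun j => (ε / 2)⁻¹ * |X ω j| :=
    fun n ω j => mul_le_mul_of_nonneg_left (hle n ω j) hc.le
  have hdct := tendsto_integral_filter_of_dominated_convergence (μ := ℙ)
    (F := fun n ω => Φ (fun j => (ε / 2)⁻¹ * |W n ω j|)) (f := fun _ => (0 : ℝ))
    (fun ω => Φ (fun j => (ε / 2)⁻¹ * |X ω j|))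
    (.of_forall fun n =>
      (hΦ.measurable_comp (measurable_mul_abs (hW n) _) (h0 n)).aestronglyMeasurable)
    (.of_forall fun n => ae_of_all _ fun ω => by
      rw [Real.norm_of_nonneg (hΦ.nonneg_s19 (h0 n ω))]
      exact hΦ.mono (h0 n ω) (hlW n ω))
    (hX.2 _ hc)
    (ae_of_all _ fun ω => by
      have ht : Tendsto (fun n => fun j => (ε / 2)⁻¹ * |W n ω j|) l
          (nhds (0 : Fin N → ℝ)) := by
        rw [tendsto_pi_nhds]
        intro j
        simpa using (((tendsto_pi_nhds.1 (hlim ω)) j).abs.const_mul (ε / 2)⁻¹)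
      have := (hΦ.2.2.1 0 (le_refl (0 : Fin N → ℝ))).tendsto.comp
        (tendsto_nhdsWithin_iff.2 ⟨ht, Eventually.of_forall fun n => h0 n ω⟩)
      rwa [hΦ.1] at this)
  rw [integral_zero] at hdct
  filter_upwards [hdct.eventually_lt_const one_pos] with n hn
  have hb : IsLuxBound ℙ Φ (W n) (ε / 2) := by
    refine ⟨by positivity, ?_, ?_⟩ <;> simp only [div_eq_inv_mul (|W n _ _|)]
    · exact hΦ.integrable_of_le (hX.2 _ hc) (measurable_mul_abs (hW n) _) (h0 n) (hlW n)
    · exact hn.le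
  rw [Real.dist_0_eq_abs, abs_of_nonneg lux_nonneg]
  linarith [hb.lux_le]

end Heart

/-- Uniform boundedness for a scalar Orlicz heart: if `f * z` is integrable for all `f` in the
heart of `φ`, then `f ↦ ∫ |f * z|` is bounded on the unit ball, by a gliding hump argument. -/
lemma exists_integral_abs_mul_le {ℙ : Measure Ω} [IsProbabilityMeasure ℙ] {φ : ℝ → ℝ}
    (hφ0 : φ 0 = 0) (hmono : ∀ x y, 0 ≤ x → x ≤ y → φ x ≤ φ y)
    (hscale : ∀ t x, 0 ≤ t → t ≤ 1 → 0 ≤ x → φ (t * x) ≤ t * φ x)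
    {A B : ℝ} (hA : 0 < A) (hAB : ∀ x, 0 ≤ x → A * x - B ≤ φ x) {z : Ω → ℝ}
    (H : ∀ f : Ω → ℝ, Measurable f → (∀ lam > (0 : ℝ), Integrable (fun ω => φ (lam * |f ω|)) ℙ) →
      Integrable (fun ω => f ω * z ω) ℙ) :
    ∃ C : ℝ, ∀ f : Ω → ℝ, Measurable f →
      (∀ lam > (0 : ℝ), Integrable (fun ω => φ (lam * |f ω|)) ℙ) →
      ∫ ω, φ |f ω| ∂ℙ ≤ 1 → ∫ ω, |f ω * z ω| ∂ℙ ≤ C := by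
  by_contra! hcon
  choose f hfm hfi hf1 hfz using fun n : ℕ => hcon (4 ^ n)
  have hnn : ∀ x, 0 ≤ x → 0 ≤ φ x := fun x hx => hφ0 ▸ hmono 0 x le_rfl hx
  have hfi1 : ∀ n, Integrable (fun ω => φ |f n ω|) ℙ := fun n => by
    simpa using hfi n 1 one_pos
  set e : ℕ → ℝ := fun n => (1 / 2) ^ n with he
  have he0 : ∀ n, 0 < e n := fun n => by positivity
  set g : Ω → ℝ≥0∞ := fun ω => ⨆ n, ENNReal.ofReal (e n * |f n ω|)
  have hgm : Measurable g := by fun_prop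
  have hgfin : ∀ᵐ ω ∂ℙ, g ω < ∞ := by
    refine ae_lt_top hgm (ne_of_lt ?_)
    have hterm : ∀ n, ∫⁻ ω, ENNReal.ofReal (e n * |f n ω|) ∂ℙ
        ≤ ENNReal.ofReal (e n * ((1 + B) / A)) := fun n => by
      have hpt : ∀ ω, e n * |f n ω| ≤ e n * ((φ |f n ω| + B) / A) := fun ω => by
        refine mul_le_mul_of_nonneg_left ?_ (he0 n).le
        rw [le_div_iff₀ hA]
        linarith [hAB _ (abs_nonneg (f n ω))]
      have hi : Integrable (fun ω => e n * ((φ |f n ω| + B) / A)) ℙ :=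
        (((hfi1 n).add (integrable_const B)).div_const A).const_mul _
      refine (lintegral_mono fun ω => ENNReal.ofReal_le_ofReal (hpt ω)).trans ?_
      rw [← ofReal_integral_eq_lintegral_ofReal hi (ae_of_all _ fun ω =>
        (mul_nonneg (he0 n).le (abs_nonneg _)).trans (hpt ω))]
      refine ENNReal.ofReal_le_ofReal ?_
      rw [integral_const_mul, integral_div, integral_add (hfi1 n) (integrable_const B)]
      simp only [integral_const, probReal_univ, one_smul]
      have := hf1 n
      have := he0 n
      gcongr
    have hK : 0 ≤ (1 + B) / A := by
      have h1 := hAB 0 le_rfl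
      rw [hφ0] at h1
      have : 0 ≤ B := by linarith
      positivity
    calc ∫⁻ ω, g ω ∂ℙ ≤ ∫⁻ ω, ∑' n, ENNReal.ofReal (e n * |f n ω|) ∂ℙ :=
          lintegral_mono fun ω => iSup_le fun n => ENNReal.le_tsum n
      _ = ∑' n, ∫⁻ ω, ENNReal.ofReal (e n * |f n ω|) ∂ℙ :=
          lintegral_tsum fun n => by fun_prop
      _ ≤ ∑' n, ENNReal.ofReal (e n * ((1 + B) / A)) := ENNReal.tsum_le_tsum hterm
      _ = ENNReal.ofReal (∑' n, e n * ((1 + B) / A)) :=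
          (ENNReal.ofReal_tsum_of_nonneg (fun n => mul_nonneg (he0 n).le hK)
            (summable_geometric_two.mul_right _)).symm
      _ < ∞ := ENNReal.ofReal_lt_top
  set F : Ω → ℝ := fun ω => (g ω).toReal
  have hFm : Measurable F := hgm.ennreal_toReal
  have hF0 : ∀ ω, 0 ≤ F ω := fun ω => ENNReal.toReal_nonneg
  have hφm : Measurable fun x => φ (max x 0) :=
    (show Monotone fun x => φ (max x 0) from fun x y hxy =>
      hmono _ _ (le_max_right _ _) (max_le_max_right 0 hxy)).measurable
  have hφF : ∀ lam > (0 : ℝ), Integrable (fun ω => φ (lam * |F ω|)) ℙ := by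
    intro lam hl
    have hm : Measurable fun ω => φ (lam * |F ω|) := by
      have := hφm.comp ((hFm.abs).const_mul lam)
      convert this using 2 with ω
      simp [max_eq_left (mul_nonneg hl.le (abs_nonneg (F ω)))]
    refine ⟨hm.aestronglyMeasurable, ?_⟩
    rw [hasFiniteIntegral_iff_ofReal (ae_of_all _ fun ω =>
      hnn _ (mul_nonneg hl.le (abs_nonneg _)))]
    have hpos : ∀ n, 0 < 2 * lam * e n := fun n => by have := he0 n; positivity
    have hpt : ∀ ω, ENNReal.ofReal (φ (lam * |F ω|)) ≤
        ∑' n, ENNReal.ofReal (φ (2 * lam * e n * |f n ω|)) := fun ω => by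
      rcases (hF0 ω).eq_or_lt with h0 | h0
      · simp [← h0, hφ0]
      · have hgt : g ω ≠ ∞ := fun h => by simp [F, h] at h0
        have hlt : ENNReal.ofReal (F ω / 2) < g ω := by
          rw [ENNReal.ofReal_lt_iff_lt_toReal (by positivity) hgt]
          exact half_lt_self h0
        obtain ⟨n, hn⟩ := lt_iSup_iff.1 hlt
        have hn' := (ENNReal.ofReal_lt_ofReal_iff_of_nonneg (by positivity)).1 hn
        refine le_trans (ENNReal.ofReal_le_ofReal (hmono _ _ (by positivity) ?_))
          (ENNReal.le_tsum n)
        rw [abs_of_pos h0]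
        nlinarith
    have hb : ∀ n, ∫⁻ ω, ENNReal.ofReal (φ (2 * lam * e n * |f n ω|)) ∂ℙ =
        ENNReal.ofReal (∫ ω, φ (2 * lam * e n * |f n ω|) ∂ℙ) := fun n =>
      (ofReal_integral_eq_lintegral_ofReal (hfi n _ (hpos n)) (ae_of_all _ fun ω =>
        hnn _ (mul_nonneg (hpos n).le (abs_nonneg _)))).symm
    have hb0 : ∀ n, 0 ≤ ∫ ω, φ (2 * lam * e n * |f n ω|) ∂ℙ := fun n =>
      integral_nonneg fun ω => hnn _ (mul_nonneg (hpos n).le (abs_nonneg _))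
    have hlim : Tendsto (fun n => 2 * lam * e n) atTop (nhds 0) := by
      simpa only [mul_zero] using (tendsto_pow_atTop_nhds_zero_of_lt_one (r := (1 / 2 : ℝ))
        (by norm_num) (by norm_num)).const_mul (2 * lam)
    have hsum : Summable fun n => ∫ ω, φ (2 * lam * e n * |f n ω|) ∂ℙ := by
      refine (summable_geometric_two.mul_left (2 * lam)).of_norm_bounded_eventually_nat ?_
      filter_upwards [hlim.eventually_lt_const one_pos] with n hn
      rw [Real.norm_of_nonneg (hb0 n)]
      calc ∫ ω, φ (2 * lam * e n * |f n ω|) ∂ℙ ≤ ∫ ω, 2 * lam * e n * φ |f n ω| ∂ℙ :=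
            integral_mono (hfi n _ (hpos n)) ((hfi1 n).const_mul _) fun ω =>
              hscale _ _ (hpos n).le hn.le (abs_nonneg _)
        _ = 2 * lam * e n * ∫ ω, φ |f n ω| ∂ℙ := integral_const_mul _ _
        _ ≤ 2 * lam * e n := mul_le_of_le_one_right (hpos n).le (hf1 n)
    have hmn : ∀ n, AEMeasurable (fun ω => ENNReal.ofReal (φ (2 * lam * e n * |f n ω|))) ℙ :=
      fun n => (hfi n _ (hpos n)).aestronglyMeasurable.aemeasurable.ennreal_ofReal
    calc ∫⁻ ω, ENNReal.ofReal (φ (lam * |F ω|)) ∂ℙ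
        ≤ ∑' n, ∫⁻ ω, ENNReal.ofReal (φ (2 * lam * e n * |f n ω|)) ∂ℙ :=
          (lintegral_mono hpt).trans_eq (lintegral_tsum hmn)
      _ = ENNReal.ofReal (∑' n, ∫ ω, φ (2 * lam * e n * |f n ω|) ∂ℙ) := by
          simp only [hb]
          exact (ENNReal.ofReal_tsum_of_nonneg hb0 hsum).symm
      _ < ∞ := ENNReal.ofReal_lt_top
  have hFz := (H F hFm hφF).abs
  have hbound : ∀ n : ℕ, (2 : ℝ) ^ n ≤ ∫ ω, |F ω * z ω| ∂ℙ := fun n => by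
    have hle : ∫ ω, e n * |f n ω * z ω| ∂ℙ ≤ ∫ ω, |F ω * z ω| ∂ℙ := by
      refine integral_mono_ae ((H (f n) (hfm n) (hfi n)).abs.const_mul _) hFz ?_
      filter_upwards [hgfin] with ω hω
      have h1 : e n * |f n ω| ≤ F ω :=
        (ENNReal.ofReal_le_iff_le_toReal hω.ne).1 (le_iSup (fun n => ENNReal.ofReal
          (e n * |f n ω|)) n)
      simp only [abs_mul, abs_of_nonneg (hF0 ω), ← mul_assoc]
      exact mul_le_mul_of_nonneg_right h1 (abs_nonneg _)
    rw [integral_const_mul] at hle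
    refine le_trans ?_ hle
    calc (2 : ℝ) ^ n = e n * 4 ^ n := by rw [he, ← mul_pow]; norm_num
      _ ≤ _ := mul_le_mul_of_nonneg_left (hfz n).le (he0 n).le
  obtain ⟨n, hn⟩ := pow_unbounded_of_one_lt (∫ ω, |F ω * z ω| ∂ℙ) (one_lt_two : (1 : ℝ) < 2)
  exact absurd (hbound n) (not_le.2 hn)

/-- An a priori bound on bounded vectors dominated by `X` extends to `X`. -/
lemma integrable_sum_abs_mul_of_bounded {N : ℕ} {ℙ : Measure Ω} {X Z : Ω → Fin N → ℝ}
    (hX : Measurable X) (hZ : Measurable Z) (hZi : ∀ j, Integrable (fun ω => Z ω j) ℙ) {D : ℝ}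
    (H : ∀ Y : Ω → Fin N → ℝ, Measurable Y → (∃ K : ℝ, ∀ ω j, |Y ω j| ≤ K) →
      (∀ ω j, |Y ω j| ≤ |X ω j|) → ∫ ω, ∑ j, Y ω j * Z ω j ∂ℙ ≤ D) :
    Integrable (fun ω => ∑ j, |X ω j * Z ω j|) ℙ ∧ ∫ ω, ∑ j, |X ω j * Z ω j| ∂ℙ ≤ D := by
  have hXj : ∀ j, Measurable fun ω => X ω j := fun j => (measurable_pi_apply j).comp hX
  have hZj : ∀ j, Measurable fun ω => Z ω j := fun j => (measurable_pi_apply j).comp hZ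
  have hm : Measurable fun ω => ∑ j, |X ω j * Z ω j| := by fun_prop
  have h0 : ∀ ω, 0 ≤ ∑ j, |X ω j * Z ω j| := fun ω => by positivity
  have hstep : ∀ n : ℕ, ∫⁻ ω, ENNReal.ofReal (∑ j, min |X ω j| n * |Z ω j|) ∂ℙ ≤
      ENNReal.ofReal D := fun n => by
    have hmin : ∀ ω j, 0 ≤ min |X ω j| (n : ℝ) := fun ω j => by positivity
    set Y : Ω → Fin N → ℝ := fun ω j =>
      if 0 ≤ Z ω j then min |X ω j| n else -min |X ω j| n with hY
    have hYm : Measurable Y := measurable_pi_lambda _ fun j =>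
      Measurable.ite (measurableSet_le measurable_const (hZj j)) (by fun_prop) (by fun_prop)
    have hYabs : ∀ ω j, |Y ω j| ≤ min |X ω j| n := fun ω j => by
      simp only [hY]
      split_ifs
      · rw [abs_of_nonneg (hmin ω j)]
      · rw [abs_neg, abs_of_nonneg (hmin ω j)]
    have heq : ∀ ω, ∑ j, Y ω j * Z ω j = ∑ j, min |X ω j| n * |Z ω j| := fun ω =>
      Finset.sum_congr rfl fun j _ => by
        simp only [hY]
        split_ifs with h
        · rw [abs_of_nonneg h]
        · rw [abs_of_neg (not_le.1 h), neg_mul_comm]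
    have hD := H Y hYm ⟨n, fun ω j => (hYabs ω j).trans (min_le_right _ _)⟩
      fun ω j => (hYabs ω j).trans (min_le_left _ _)
    simp only [heq] at hD
    have hi : Integrable (fun ω => ∑ j, min |X ω j| n * |Z ω j|) ℙ := by
      refine integrable_finsetSum _ fun j _ => ?_
      refine (hZi j).abs.bdd_mul (c := n) (by fun_prop) (ae_of_all _ fun ω => ?_)
      rw [Real.norm_of_nonneg (hmin ω j)]
      exact min_le_right _ _
    rw [← ofReal_integral_eq_lintegral_ofReal hi (ae_of_all _ fun ω =>
      Finset.sum_nonneg fun j _ => mul_nonneg (hmin ω j) (abs_nonneg _))]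
    exact ENNReal.ofReal_le_ofReal hD
  have hlint : ∫⁻ ω, ENNReal.ofReal (∑ j, |X ω j * Z ω j|) ∂ℙ ≤ ENNReal.ofReal D := by
    have hconv : Tendsto (fun n : ℕ => ∫⁻ ω, ENNReal.ofReal (∑ j, min |X ω j| n * |Z ω j|) ∂ℙ)
        atTop (nhds (∫⁻ ω, ENNReal.ofReal (∑ j, |X ω j * Z ω j|) ∂ℙ)) := by
      refine lintegral_tendsto_of_tendsto_of_monotone (fun n => by fun_prop)
        (ae_of_all _ fun ω m n hmn => ?_) (ae_of_all _ fun ω => ?_)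
      · dsimp only
        gcongr
      · refine tendsto_const_nhds.congr' ?_
        obtain ⟨n₀, hn₀⟩ := exists_nat_ge (∑ j, |X ω j|)
        filter_upwards [eventually_ge_atTop n₀] with n hn
        congr 1
        refine Finset.sum_congr rfl fun j _ => ?_
        rw [abs_mul, min_eq_left]
        calc |X ω j| ≤ ∑ j, |X ω j| :=
              Finset.single_le_sum (f := fun j => |X ω j|) (fun _ _ => abs_nonneg _)
                (Finset.mem_univ j)
          _ ≤ n₀ := hn₀
          _ ≤ n := by exact_mod_cast hn
    exact le_of_tendsto' hconv hstep
  have hint : Integrable (fun ω => ∑ j, |X ω j * Z ω j|) ℙ :=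
    ⟨hm.aestronglyMeasurable, by
      rw [hasFiniteIntegral_iff_ofReal (ae_of_all _ h0)]
      exact hlint.trans_lt ENNReal.ofReal_lt_top⟩
  refine ⟨hint, ?_⟩
  have hD0 : 0 ≤ D := by simpa using H 0 measurable_const ⟨0, by simp⟩ (by simp)
  rw [← ofReal_integral_eq_lintegral_ofReal hint (ae_of_all _ h0)] at hlint
  exact (ENNReal.ofReal_le_ofReal_iff hD0).1 hlint

/-- An order-continuous linear functional on bounded random variables that vanishes on null sets
has an integrable density. -/
lemma exists_integrable_density {ℙ : Measure Ω} [IsFiniteMeasure ℙ] (τ : (Ω → ℝ) →ₗ[ℝ] ℝ)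
    (hcont : ∀ {ι : Type} (l : Filter ι) [l.IsCountablyGenerated] (W : ι → Ω → ℝ) (K : ℝ),
      (∀ i, Measurable (W i)) → (∀ i ω, |W i ω| ≤ K) →
      (∀ ω, Tendsto (fun i => W i ω) l (nhds 0)) → Tendsto (fun i => τ (W i)) l (nhds 0))
    (hnull : ∀ s, MeasurableSet s → ℙ s = 0 → τ (s.indicator 1) = 0) :
    ∃ z : Ω → ℝ, Measurable z ∧ Integrable z ℙ ∧
      ∀ f : Ω → ℝ, Measurable f → (∃ K : ℝ, ∀ ω, |f ω| ≤ K) → τ f = ∫ ω, f ω * z ω ∂ℙ := by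
  let ν : SignedMeasure Ω :=
    { measureOf' := fun s => if MeasurableSet s then τ (s.indicator 1) else 0
      empty' := by
        rw [if_pos .empty, Set.indicator_empty']
        exact map_zero τ
      not_measurable' := fun s hs => if_neg hs
      m_iUnion' := fun s hs hd => by
        simp only [hs, MeasurableSet.iUnion hs, if_true]
        have hpt : ∀ ω, HasSum (fun i => (s i).indicator (1 : Ω → ℝ) ω)
            ((⋃ i, s i).indicator 1 ω) := fun ω => by
          by_cases hω : ω ∈ ⋃ i, s i
          · obtain ⟨i, hi⟩ := Set.mem_iUnion.1 hω
            rw [Set.indicator_of_mem hω, ← Set.indicator_of_mem hi (1 : Ω → ℝ)]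
            exact hasSum_single i fun k hk => Set.indicator_of_notMem
              (fun h => Set.disjoint_left.1 (hd hk) h hi) _
          · rw [Set.indicator_of_notMem hω]
            convert hasSum_zero with i
            exact Set.indicator_of_notMem (fun h => hω (Set.mem_iUnion_of_mem i h)) _
        have h01 : ∀ (t : Set Ω) ω, 0 ≤ t.indicator (1 : Ω → ℝ) ω := fun t ω =>
          Set.indicator_nonneg (by simp) ω
        have h := hcont atTop
          (fun F : Finset ℕ => (⋃ i, s i).indicator 1 - ∑ i ∈ F, (s i).indicator 1) 1
          (fun F => (measurable_one.indicator (.iUnion hs)).sub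
            (by
              rw [Finset.sum_fn]
              exact Finset.measurable_sum _ fun i _ => measurable_one.indicator (hs i)))
          (fun F ω => by
            have h1 := sum_le_hasSum F (fun i _ => h01 (s i) ω) (hpt ω)
            have h2 : 0 ≤ ∑ i ∈ F, (s i).indicator (1 : Ω → ℝ) ω :=
              Finset.sum_nonneg fun i _ => h01 (s i) ω
            have h3 : (⋃ i, s i).indicator (1 : Ω → ℝ) ω ≤ 1 :=
              Set.indicator_le_self' (by simp) ω
            simp only [Pi.sub_apply, Finset.sum_apply]
            rw [abs_of_nonneg (by linarith)]
            linarith)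
          (fun ω => by
            simp only [Pi.sub_apply, Finset.sum_apply]
            simpa using (hpt ω).const_sub ((⋃ i, s i).indicator 1 ω))
        simp only [map_sub, map_sum] at h
        simpa [HasSum] using h.const_sub (τ ((⋃ i, s i).indicator 1)) }
  have hν : ∀ s, MeasurableSet s → ν s = τ (s.indicator 1) := fun s hs => if_pos hs
  have hac : ν ≪ᵥ ℙ.toENNRealVectorMeasure := by
    refine VectorMeasure.AbsolutelyContinuous.mk fun s hs h0 => ?_
    rw [Measure.toENNRealVectorMeasure_apply_measurable hs] at h0
    rw [hν s hs, hnull s hs h0]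
  have hzi : Integrable (ν.rnDeriv ℙ) ℙ := SignedMeasure.integrable_rnDeriv ν ℙ
  have hind : ∀ s, MeasurableSet s → τ (s.indicator 1) = ∫ ω in s, ν.rnDeriv ℙ ω ∂ℙ :=
    fun s hs => by
      rw [← hν s hs, ← withDensityᵥ_apply hzi hs, SignedMeasure.withDensityᵥ_rnDeriv_eq ν ℙ hac]
  have hbdd : ∀ f : Ω → ℝ, Measurable f → ∀ K : ℝ, (∀ ω, |f ω| ≤ K) →
      Integrable (fun ω => f ω * ν.rnDeriv ℙ ω) ℙ := fun f hf K hK =>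
    hzi.bdd_mul (c := K) hf.aestronglyMeasurable (ae_of_all _ hK)
  have hsimple : ∀ f : SimpleFunc Ω ℝ, τ f = ∫ ω, f ω * ν.rnDeriv ℙ ω ∂ℙ := fun f => by
    induction f using SimpleFunc.induction with
    | const c hs =>
      rename_i s
      have h1 : (⇑((SimpleFunc.const Ω c).piecewise s hs (SimpleFunc.const Ω 0)) : Ω → ℝ) =
          c • s.indicator 1 := by
        ext ω
        by_cases h : ω ∈ s <;> simp [h]
      rw [h1, map_smul, hind s hs, ← integral_indicator hs, smul_eq_mul, ← integral_const_mul]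
      congr 1
      ext ω
      by_cases h : ω ∈ s <;> simp [h]
    | add hd hf hg =>
      rename_i f g
      obtain ⟨K, hK⟩ := f.exists_forall_norm_le
      obtain ⟨K', hK'⟩ := g.exists_forall_norm_le
      rw [SimpleFunc.coe_add, map_add, hf, hg,
        ← integral_add (hbdd f f.measurable K hK) (hbdd g g.measurable K' hK')]
      simp only [Pi.add_apply, add_mul]
  refine ⟨ν.rnDeriv ℙ, SignedMeasure.measurable_rnDeriv ν ℙ, hzi, fun f hf ⟨K, hK⟩ => ?_⟩
  let a : ℕ → SimpleFunc Ω ℝ := SimpleFunc.approxOn f hf Set.univ 0 (Set.mem_univ 0)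
  have halim : ∀ ω, Tendsto (fun n => a n ω) atTop (nhds (f ω)) := fun ω =>
    SimpleFunc.tendsto_approxOn hf _ (by simp)
  have habd : ∀ n ω, |a n ω| ≤ 2 * K := fun n ω => by
    have := SimpleFunc.norm_approxOn_y₀_le hf (Set.mem_univ (0 : ℝ)) ω n
    simp only [sub_zero, Real.norm_eq_abs] at this
    change |a n ω| ≤ _ at this
    linarith [hK ω]
  have h1 : Tendsto (fun n => τ (a n)) atTop (nhds (τ f)) := by
    have h := hcont atTop (fun n => f - a n) (3 * K) (fun n => hf.sub (a n).measurable)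
      (fun n ω => (abs_sub _ _).trans (by linarith [hK ω, habd n ω]))
      (fun ω => by simpa using (halim ω).const_sub (f ω))
    simp only [map_sub] at h
    simpa using h.const_sub (τ f)
  have h2 : Tendsto (fun n => τ (a n)) atTop (nhds (∫ ω, f ω * ν.rnDeriv ℙ ω ∂ℙ)) := by
    simp only [hsimple]
    refine tendsto_integral_of_dominated_convergence (fun ω => 2 * K * |ν.rnDeriv ℙ ω|)
      (fun n => (hbdd _ (a n).measurable _ (habd n)).aestronglyMeasurable)
      (hzi.abs.const_mul _) (fun n => ae_of_all _ fun ω => ?_)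
      (ae_of_all _ fun ω => (halim ω).mul_const _)
    rw [norm_mul]
    exact mul_le_mul_of_nonneg_right (habd n ω) (abs_nonneg _)
  exact tendsto_nhds_unique h1 h2

section Duality

variable {N : ℕ} {Φ : (Fin N → ℝ) → ℝ} {ℙ : Measure Ω} {X Z : Ω → Fin N → ℝ}

/-- A random variable, seen as a random vector concentrated on the coordinate `j`. -/
def embed (Ω : Type*) {N : ℕ} (j : Fin N) : (Ω → ℝ) →ₗ[ℝ] (Ω → Fin N → ℝ) :=
  (LinearMap.single ℝ (fun _ : Fin N => ℝ) j).compLeft Ω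

lemma embed_apply {Ω : Type*} (j : Fin N) (f : Ω → ℝ) (ω : Ω) : embed Ω j f ω = Pi.single j (f ω) := rfl

lemma measurable_embed (j : Fin N) {f : Ω → ℝ} (hf : Measurable f) : Measurable (embed Ω j f) :=
  measurable_pi_lambda _ fun i => by
    rcases eq_or_ne i j with rfl | h
    · simpa [embed_apply] using hf
    · simp [embed_apply, h]

lemma abs_embed_le {Ω : Type*} (j : Fin N) {f : Ω → ℝ} {g : Ω → Fin N → ℝ}
    (h : ∀ ω, |f ω| ≤ |g ω j|) (ω : Ω) (i : Fin N) : |embed Ω j f ω i| ≤ |g ω i| := by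
  rcases eq_or_ne i j with rfl | hij
  · simpa [embed_apply] using h ω
  · simp [embed_apply, hij]

lemma mul_abs_embed {Ω : Type*} (j : Fin N) (f : Ω → ℝ) (c : ℝ) (ω : Ω) :
    (fun i => c * |embed Ω j f ω i|) = Pi.single j (c * |f ω|) := by
  ext i
  rcases eq_or_ne i j with rfl | h
  · simp [embed_apply]
  · simp [embed_apply, h]

lemma sum_embed_mul {Ω : Type*} (j : Fin N) (f : Ω → ℝ) (Z : Ω → Fin N → ℝ) (ω : Ω) :
    ∑ i, embed Ω j f ω i * Z ω i = f ω * Z ω j := by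
  rw [Finset.sum_eq_single j] <;> simp +contextual [embed_apply]

lemma sum_embed {Ω : Type*} (X : Ω → Fin N → ℝ) : ∑ j, embed Ω j (fun ω => X ω j) = X := by
  ext ω i
  simp [embed_apply, Finset.sum_apply, Finset.sum_pi_single]

lemma measurable_apply (hX : Measurable X) (j : Fin N) : Measurable fun ω => X ω j :=
  (measurable_pi_apply j).comp hX

lemma IsLuxBound.mem_Lspace {c : ℝ} (h : IsLuxBound ℙ Φ X c) (hX : Measurable X) :
    X ∈ Lspace ℙ Φ :=
  ⟨hX, c⁻¹, inv_pos.2 h.1, by simpa only [div_eq_inv_mul] using h.2.1⟩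

lemma integrable_apply_mul (hΦ : MultiOrlicz Φ)
    (H : ∀ X ∈ Mspace ℙ Φ, Integrable (fun ω => ∑ j, X ω j * Z ω j) ℙ)
    (hX : X ∈ Mspace ℙ Φ) (j : Fin N) : Integrable (fun ω => X ω j * Z ω j) ℙ := by
  have h := H _ (mem_Mspace_of_abs_le hΦ hX
    (measurable_embed j (measurable_apply hX.1 j)) (abs_embed_le j fun _ => le_rfl))
  simpa only [sum_embed_mul] using h

lemma integrable_apply_of_heart [IsFiniteMeasure ℙ] (hΦ : MultiOrlicz Φ)
    (H : ∀ X ∈ Mspace ℙ Φ, Integrable (fun ω => ∑ j, X ω j * Z ω j) ℙ) (j : Fin N) :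
    Integrable (fun ω => Z ω j) ℙ := by
  simpa using integrable_apply_mul hΦ H
    (mem_Mspace_of_bounded_s19 hΦ (Y := fun _ _ => (1 : ℝ)) measurable_const (K := 1) (by simp)) j

lemma exists_bound_of_isLuxBound_one [IsProbabilityMeasure ℙ] (hΦ : MultiOrlicz Φ)
    (H : ∀ X ∈ Mspace ℙ Φ, Integrable (fun ω => ∑ j, X ω j * Z ω j) ℙ) :
    ∃ C : ℝ, ∀ X ∈ Mspace ℙ Φ, IsLuxBound ℙ Φ X 1 → ∫ ω, ∑ j, |X ω j * Z ω j| ∂ℙ ≤ C := by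
  obtain ⟨A, hA, B, hAB⟩ := hΦ.2.2.2.2
  have hs0 : ∀ (j : Fin N) (x : ℝ), 0 ≤ x → (0 : Fin N → ℝ) ≤ Pi.single j x :=
    fun j x hx => Pi.single_nonneg.2 hx
  have hcomp : ∀ j : Fin N, ∃ C : ℝ, ∀ f : Ω → ℝ, Measurable f →
      (∀ lam > (0 : ℝ), Integrable (fun ω => Φ (Pi.single j (lam * |f ω|))) ℙ) →
      ∫ ω, Φ (Pi.single j |f ω|) ∂ℙ ≤ 1 → ∫ ω, |f ω * Z ω j| ∂ℙ ≤ C := fun j =>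
    exists_integral_abs_mul_le (φ := fun x => Φ (Pi.single j x)) (by simp [hΦ.1])
      (fun x y hx hxy => hΦ.mono (hs0 j x hx) (Pi.single_le_single.2 hxy))
      (fun t x ht ht1 hx => by
        simpa [← Pi.single_smul] using hΦ.map_smul_le ht ht1 (hs0 j x hx))
      hA (B := B) (fun x hx => by simpa using hAB _ (hs0 j x hx))
      fun f hf hfi => by
        simpa only [sum_embed_mul] using H (embed Ω j f) ⟨measurable_embed j hf, fun lam hl => by
          simpa only [mul_abs_embed] using hfi lam hl⟩
  choose C hC using hcomp
  refine ⟨∑ j, C j, fun X hX hb => ?_⟩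
  rw [integral_finsetSum _ fun j _ => (integrable_apply_mul hΦ H hX j).abs]
  refine Finset.sum_le_sum fun j _ => hC j _ (measurable_apply hX.1 j) (fun lam hl => ?_) ?_
  · have := (mem_Mspace_of_abs_le hΦ hX
      (measurable_embed j (measurable_apply hX.1 j)) (abs_embed_le j fun _ => le_rfl)).2 lam hl
    simpa only [mul_abs_embed] using this
  · have := (hb.of_le hΦ le_rfl (measurable_embed j (measurable_apply hX.1 j))
      (abs_embed_le j fun _ => le_rfl)).2.2
    have h := mul_abs_embed j (fun ω => X ω j) 1
    simp only [one_mul] at h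
    simpa only [div_one, h] using this

lemma exists_bound_of_lux_le_one [IsProbabilityMeasure ℙ] (hΦ : MultiOrlicz Φ) (hZ : Measurable Z)
    (H : ∀ X ∈ Mspace ℙ Φ, Integrable (fun ω => ∑ j, X ω j * Z ω j) ℙ) :
    ∃ C : ℝ, ∀ X ∈ Lspace ℙ Φ, lux ℙ Φ X ≤ 1 →
      Integrable (fun ω => ∑ j, |X ω j * Z ω j|) ℙ ∧ ∫ ω, ∑ j, |X ω j * Z ω j| ∂ℙ ≤ C := by
  obtain ⟨C, hC⟩ := exists_bound_of_isLuxBound_one hΦ H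
  refine ⟨2 * C, fun X hX hX1 => integrable_sum_abs_mul_of_bounded hX.1 hZ
    (integrable_apply_of_heart hΦ H) fun Y hY ⟨K, hK⟩ hYX => ?_⟩
  have hYM := mem_Mspace_of_bounded_s19 (ℙ := ℙ) hΦ hY hK
  have hb : IsLuxBound ℙ Φ Y 2 := isLuxBound_of_lux_lt hΦ (Mspace_subset_Lspace hYM)
    (by linarith [lux_le_of_abs_le hΦ hX hY hYX])
  have h := hC _ (smul_mem_Mspace hΦ hYM (2 : ℝ)⁻¹) hb.inv_smul
  have heq : ∀ ω, ∑ j, |((2 : ℝ)⁻¹ • Y) ω j * Z ω j| = 2⁻¹ * ∑ j, |Y ω j * Z ω j| := fun ω => by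
    simp [abs_mul, Finset.mul_sum, mul_assoc]
  simp only [heq, integral_const_mul] at h
  have hle : ∫ ω, ∑ j, Y ω j * Z ω j ∂ℙ ≤ ∫ ω, ∑ j, |Y ω j * Z ω j| ∂ℙ :=
    integral_mono (H Y hYM) (integrable_finsetSum _ fun j _ =>
      (integrable_apply_mul hΦ H hYM j).abs) fun ω =>
        Finset.sum_le_sum fun j _ => le_abs_self _
  linarith

lemma integrable_sum_mul_of_abs (hX : Measurable X) (hZ : Measurable Z)
    (h : Integrable (fun ω => ∑ j, |X ω j * Z ω j|) ℙ) :
    Integrable (fun ω => ∑ j, X ω j * Z ω j) ℙ := by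
  have hXj := measurable_apply hX
  have hZj := measurable_apply hZ
  exact h.mono' (by fun_prop) (ae_of_all _ fun ω => Finset.abs_sum_le_sum_abs _ _)

lemma mem_Kdual_of_heart [IsProbabilityMeasure ℙ] (hΦ : MultiOrlicz Φ) (hZ : Measurable Z)
    (H : ∀ X ∈ Mspace ℙ Φ, Integrable (fun ω => ∑ j, X ω j * Z ω j) ℙ) : Z ∈ Kdual ℙ Φ := by
  refine ⟨hZ, fun X hX => ?_⟩
  obtain ⟨C, hC⟩ := exists_bound_of_lux_le_one hΦ hZ H
  obtain ⟨c, hc⟩ := exists_isLuxBound hΦ hX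
  have hm := hX.1.const_smul c⁻¹
  have h := integrable_sum_mul_of_abs hm hZ
    (hC _ (hc.inv_smul.mem_Lspace hm) hc.inv_smul.lux_le).1
  refine (h.const_mul c).congr (ae_of_all _ fun ω => ?_)
  simp [Finset.mul_sum, ← mul_assoc, mul_inv_cancel₀ hc.1.ne']

/-- The dual norm on the Köthe dual. -/
def dualNorm (ℙ : Measure Ω) (Φ : (Fin N → ℝ) → ℝ) (Z : Ω → Fin N → ℝ) : ℝ :=
  sSup {r | ∃ X ∈ Lspace ℙ Φ, lux ℙ Φ X ≤ 1 ∧ r = ∫ ω, |∑ j, X ω j * Z ω j| ∂ℙ}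

lemma Kdual.integrable_heart (hZ : Z ∈ Kdual ℙ Φ) :
    ∀ X ∈ Mspace ℙ Φ, Integrable (fun ω => ∑ j, X ω j * Z ω j) ℙ :=
  fun X hX => hZ.2 X (Mspace_subset_Lspace hX)

lemma bddAbove_dualNorm [IsProbabilityMeasure ℙ] (hΦ : MultiOrlicz Φ) (hZ : Z ∈ Kdual ℙ Φ) :
    BddAbove {r | ∃ X ∈ Lspace ℙ Φ, lux ℙ Φ X ≤ 1 ∧ r = ∫ ω, |∑ j, X ω j * Z ω j| ∂ℙ} := by
  obtain ⟨C, hC⟩ := exists_bound_of_lux_le_one hΦ hZ.1 (Kdual.integrable_heart hZ)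
  refine ⟨C, ?_⟩
  rintro _ ⟨X, hX, hX1, rfl⟩
  obtain ⟨hi, hle⟩ := hC X hX hX1
  exact (integral_mono (hZ.2 X hX).abs hi fun ω => Finset.abs_sum_le_sum_abs _ _).trans hle

lemma abs_integral_le_dualNorm [IsProbabilityMeasure ℙ] (hΦ : MultiOrlicz Φ)
    (hZ : Z ∈ Kdual ℙ Φ) (hX : X ∈ Mspace ℙ Φ) (hX1 : lux ℙ Φ X ≤ 1) :
    |∫ ω, ∑ j, X ω j * Z ω j ∂ℙ| ≤ dualNorm ℙ Φ Z :=
  abs_integral_le_integral_abs.trans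
    (le_csSup (bddAbove_dualNorm hΦ hZ) ⟨X, Mspace_subset_Lspace hX, hX1, rfl⟩)

lemma lux_zero_le_one [IsFiniteMeasure ℙ] (hΦ : MultiOrlicz Φ) :
    lux ℙ Φ (0 : Ω → Fin N → ℝ) ≤ 1 := by
  have h : (fun _ => 0 : Fin N → ℝ) = 0 := rfl
  exact IsLuxBound.lux_le ⟨one_pos, by simp [h, hΦ.1], by simp [h, hΦ.1]⟩

lemma abs_integral_le_dualNorm_mul_lux [IsProbabilityMeasure ℙ] (hΦ : MultiOrlicz Φ)
    (hZ : Z ∈ Kdual ℙ Φ) (hX : X ∈ Mspace ℙ Φ) :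
    |∫ ω, ∑ j, X ω j * Z ω j ∂ℙ| ≤ dualNorm ℙ Φ Z * lux ℙ Φ X := by
  have hd : 0 ≤ dualNorm ℙ Φ Z := (abs_nonneg _).trans
    (abs_integral_le_dualNorm hΦ hZ (zero_mem_Mspace hΦ) (lux_zero_le_one hΦ))
  have hbound : ∀ c, IsLuxBound ℙ Φ X c →
      |∫ ω, ∑ j, X ω j * Z ω j ∂ℙ| ≤ dualNorm ℙ Φ Z * c := fun c hc => by
    have h := abs_integral_le_dualNorm hΦ hZ (smul_mem_Mspace hΦ hX c⁻¹) hc.inv_smul.lux_le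
    have heq : ∀ ω, ∑ j, (c⁻¹ • X) ω j * Z ω j = c⁻¹ * ∑ j, X ω j * Z ω j := fun ω => by
      simp [Finset.mul_sum, mul_assoc]
    simp only [heq, integral_const_mul] at h
    rwa [abs_mul, abs_of_pos (inv_pos.2 hc.1), inv_mul_le_iff₀ hc.1, mul_comm] at h
  refine ge_of_tendsto' (x := atTop) (f := fun n : ℕ =>
    dualNorm ℙ Φ Z * (lux ℙ Φ X + 1 / ((n : ℝ) + 1))) ?_ fun n =>
      hbound _ (isLuxBound_of_lux_lt hΦ (Mspace_subset_Lspace hX) (by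
        linarith [Nat.one_div_pos_of_nat (α := ℝ) (n := n)]))
  simpa using (tendsto_one_div_add_atTop_nhds_zero_nat.const_add (lux ℙ Φ X)).const_mul
    (dualNorm ℙ Φ Z)

lemma dualNorm_eq_sSup_heart [IsProbabilityMeasure ℙ] (hΦ : MultiOrlicz Φ)
    (hZ : Z ∈ Kdual ℙ Φ) :
    dualNorm ℙ Φ Z = sSup {r | ∃ X ∈ Mspace ℙ Φ, lux ℙ Φ X ≤ 1 ∧
      r = |∫ ω, ∑ j, X ω j * Z ω j ∂ℙ|} := by
  have H := Kdual.integrable_heart hZ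
  apply le_antisymm
  · refine csSup_le ⟨_, 0, Mspace_subset_Lspace (zero_mem_Mspace hΦ), lux_zero_le_one hΦ, rfl⟩ ?_
    rintro _ ⟨X, hX, hX1, rfl⟩
    obtain ⟨hi, hle⟩ := integrable_sum_abs_mul_of_bounded hX.1 hZ.1
      (integrable_apply_of_heart hΦ H) fun Y hY ⟨K, hK⟩ hYX => (le_abs_self _).trans <|
        le_csSup (s := {r | ∃ X ∈ Mspace ℙ Φ, lux ℙ Φ X ≤ 1 ∧
          r = |∫ ω, ∑ j, X ω j * Z ω j ∂ℙ|})
          ⟨dualNorm ℙ Φ Z, by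
            rintro _ ⟨X, hX, hX1, rfl⟩
            exact abs_integral_le_dualNorm hΦ hZ hX hX1⟩
          ⟨Y, mem_Mspace_of_bounded_s19 hΦ hY hK, (lux_le_of_abs_le hΦ hX hY hYX).trans hX1, rfl⟩
    exact (integral_mono (hZ.2 X hX).abs hi fun ω => Finset.abs_sum_le_sum_abs _ _).trans hle
  · refine csSup_le ⟨_, 0, zero_mem_Mspace hΦ, lux_zero_le_one hΦ, rfl⟩ ?_
    rintro _ ⟨X, hX, hX1, rfl⟩
    exact abs_integral_le_dualNorm hΦ hZ hX hX1

/-- A linear functional bounded for the Luxemburg norm is order continuous on the heart. -/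
lemma tendsto_of_abs_le_lux (hΦ : MultiOrlicz Φ) {T : (Ω → Fin N → ℝ) →ₗ[ℝ] ℝ} {C : ℝ}
    (hC : ∀ X ∈ Mspace ℙ Φ, |T X| ≤ C * lux ℙ Φ X) (hX : X ∈ Mspace ℙ Φ) {ι : Type*}
    {l : Filter ι} [l.IsCountablyGenerated] {W : ι → Ω → Fin N → ℝ} (hW : ∀ n, Measurable (W n))
    (hle : ∀ n ω j, |W n ω j| ≤ |X ω j|) (hlim : ∀ ω, Tendsto (fun n => W n ω) l (nhds 0)) :
    Tendsto (fun n => T (W n)) l (nhds 0) :=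
  squeeze_zero_norm (fun n => hC _ (mem_Mspace_of_abs_le hΦ hX (hW n) (hle n)))
    (by simpa using (tendsto_lux_zero hΦ hX hW hle hlim).const_mul C)

lemma lux_eq_zero_of_ae_eq_zero (hΦ : MultiOrlicz Φ) (hX : X =ᵐ[ℙ] 0) : lux ℙ Φ X = 0 := by
  refine le_antisymm (le_of_forall_gt_imp_ge_of_dense fun c hc => IsLuxBound.lux_le ?_) lux_nonneg
  have h : (fun ω => Φ fun j => |X ω j| / c) =ᵐ[ℙ] fun _ => 0 := by
    filter_upwards [hX] with ω hω
    simp only [hω, Pi.zero_apply, abs_zero, zero_div]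
    exact hΦ.1
  exact ⟨hc, (integrable_zero _ _ _).congr h.symm, by simp [integral_congr_ae h]⟩

lemma exists_mem_Kdual_representing [IsProbabilityMeasure ℙ] (hΦ : MultiOrlicz Φ)
    {T : (Ω → Fin N → ℝ) →ₗ[ℝ] ℝ} {C : ℝ} (hC0 : 0 ≤ C)
    (hC : ∀ X ∈ Mspace ℙ Φ, |T X| ≤ C * lux ℙ Φ X) :
    ∃ Z ∈ Kdual ℙ Φ, ∀ X ∈ Mspace ℙ Φ, T X = ∫ ω, ∑ j, X ω j * Z ω j ∂ℙ := by
  choose z hzm hzi hz using fun j : Fin N =>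
    exists_integrable_density (ℙ := ℙ) (T.comp (embed Ω j))
      (fun {ι} l _ W K hW hK hlim =>
        tendsto_of_abs_le_lux hΦ hC (mem_Mspace_of_bounded_s19 hΦ (Y := fun _ _ => |K|)
          measurable_const (K := |K|) (by simp)) (fun n => measurable_embed j (hW n))
          (fun n => abs_embed_le j fun ω => by simpa using (hK n ω).trans (le_abs_self K))
          fun ω => by
            have hc : Continuous fun x : ℝ => (Pi.single j x : Fin N → ℝ) :=
              continuous_single (A := fun _ : Fin N => ℝ) j
            simpa only [Pi.single_zero] using! (hc.tendsto 0).comp (hlim ω))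
      (fun s hs h0 => by
        have hm := measurable_embed j ((measurable_one (α := ℝ) (β := Ω)).indicator hs)
        have h1 := hC _ (mem_Mspace_of_bounded_s19 hΦ (K := 1) hm
          (fun ω i => (abs_embed_le j (g := fun _ _ => 1) (fun ω => by
            by_cases h : ω ∈ s <;> simp [h]) ω i).trans (by simp)))
        rw [lux_eq_zero_of_ae_eq_zero hΦ, mul_zero] at h1
        · exact abs_nonpos_iff.1 h1
        · filter_upwards [measure_eq_zero_iff_ae_notMem.1 h0] with ω hω
          simp [embed_apply, hω])
  set Z : Ω → Fin N → ℝ := fun ω j => z j ω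
  have hZ : Measurable Z := measurable_pi_lambda _ hzm
  have hbdd : ∀ Y : Ω → Fin N → ℝ, Measurable Y → ∀ K : ℝ, (∀ ω j, |Y ω j| ≤ K) →
      T Y = ∫ ω, ∑ j, Y ω j * Z ω j ∂ℙ := fun Y hY K hK => by
    rw [integral_finsetSum _ fun j _ => (hzi j).bdd_mul (c := K)
      (measurable_apply hY j).aestronglyMeasurable (ae_of_all _ fun ω => hK ω j)]
    conv_lhs => rw [← sum_embed Y, map_sum]
    exact Finset.sum_congr rfl fun j _ =>
      hz j _ (measurable_apply hY j) ⟨K, fun ω => hK ω j⟩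
  have habs : ∀ X ∈ Mspace ℙ Φ, Integrable (fun ω => ∑ j, |X ω j * Z ω j|) ℙ := fun X hX =>
    (integrable_sum_abs_mul_of_bounded hX.1 hZ hzi (D := C * lux ℙ Φ X)
      fun Y hY ⟨K, hK⟩ hYX => by
        rw [← hbdd Y hY K hK]
        exact (le_abs_self _).trans <| (hC Y (mem_Mspace_of_bounded_s19 hΦ hY hK)).trans <|
          mul_le_mul_of_nonneg_left
            (lux_le_of_abs_le hΦ (Mspace_subset_Lspace hX) hY hYX) hC0).1
  refine ⟨Z, mem_Kdual_of_heart hΦ hZ fun X hX => integrable_sum_mul_of_abs hX.1 hZ (habs X hX),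
    fun X hX => ?_⟩
  let V : ℕ → Ω → Fin N → ℝ := fun n ω j => if |X ω j| ≤ n then X ω j else 0
  have hXj := measurable_apply hX.1
  have hV : ∀ n, Measurable (V n) := fun n => measurable_pi_lambda _ fun j =>
    Measurable.ite (measurableSet_le (hXj j).abs measurable_const) (hXj j) measurable_const
  have hVX : ∀ n ω j, |V n ω j| ≤ |X ω j| := fun n ω j => by
    dsimp only [V]
    split_ifs <;> simp
  have hVlim : ∀ ω j, Tendsto (fun n => V n ω j) atTop (nhds (X ω j)) := fun ω j => by
    refine tendsto_const_nhds.congr' ?_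
    obtain ⟨n₀, hn₀⟩ := exists_nat_ge |X ω j|
    filter_upwards [eventually_ge_atTop n₀] with n hn
    exact (if_pos (hn₀.trans (by exact_mod_cast hn))).symm
  have h1 : Tendsto (fun n => T (V n)) atTop (nhds (T X)) := by
    have h := tendsto_of_abs_le_lux (l := atTop) (W := fun n => X - V n) hΦ hC hX
      (fun n => hX.1.sub (hV n))
      (fun n ω j => by
        dsimp only [V, Pi.sub_apply]
        split_ifs <;> simp)
      (fun ω => tendsto_pi_nhds.2 fun j => by simpa using (hVlim ω j).const_sub (X ω j))
    simp only [map_sub] at h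
    simpa using h.const_sub (T X)
  have h2 : Tendsto (fun n => T (V n)) atTop (nhds (∫ ω, ∑ j, X ω j * Z ω j ∂ℙ)) := by
    have hTV : ∀ n, T (V n) = ∫ ω, ∑ j, V n ω j * Z ω j ∂ℙ := fun n =>
      hbdd _ (hV n) n fun ω j => by
        dsimp only [V]
        split_ifs with h <;> simp [h]
    simp only [hTV]
    refine tendsto_integral_of_dominated_convergence (fun ω => ∑ j, |X ω j * Z ω j|)
      (fun n => ?_) (habs X hX) (fun n => ae_of_all _ fun ω => ?_)
      (ae_of_all _ fun ω => tendsto_finsetSum _ fun j _ => (hVlim ω j).mul_const _)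
    · have hVj := measurable_apply (hV n)
      have hZj := measurable_apply hZ
      fun_prop
    · refine (Finset.abs_sum_le_sum_abs _ _).trans (Finset.sum_le_sum fun j _ => ?_)
      rw [abs_mul, abs_mul]
      exact mul_le_mul_of_nonneg_right (hVX n ω j) (abs_nonneg _)
  exact tendsto_nhds_unique h1 h2

end Duality

/-- Proposition 2.4 and 2.5: the Köthe dual `K_Φ` is (isometrically) the topological
dual of the Orlicz heart `(M^Φ, ‖·‖_Φ)`, `K_Φ` is characterized through `M^Φ`, and
`K_Φ ⊆ (L¹(ℙ))^N` (Statement 19). -/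
theorem koethe_dual_of_heart
    {Ω : Type*} [MeasurableSpace Ω] (ℙ : Measure Ω) [IsProbabilityMeasure ℙ]
    {N : ℕ} (hN : 1 ≤ N)
    (Φ : (Fin N → ℝ) → ℝ) (hΦ : MultiOrlicz Φ) :
    -- Luxemburg norm
    let lux : (Ω → Fin N → ℝ) → ℝ := fun X =>
      sInf {lam : ℝ | 0 < lam ∧
        Integrable (fun ω => Φ (fun j => |X ω j| / lam)) ℙ ∧
        (∫ ω, Φ (fun j => |X ω j| / lam) ∂ℙ) ≤ 1}
    -- dual norm on K_Φ
    let dualNorm : (Ω → Fin N → ℝ) → ℝ := fun Z =>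
      sSup {r | ∃ X ∈ Lspace ℙ Φ, lux X ≤ 1 ∧ r = ∫ ω, |∑ j, X ω j * Z ω j| ∂ℙ}
    -- K_Φ is determined by M^Φ
    (Kdual ℙ Φ = {Z : Ω → Fin N → ℝ | Measurable Z ∧
      ∀ X ∈ Mspace ℙ Φ, Integrable (fun ω => ∑ j, X ω j * Z ω j) ℙ}) ∧
    -- K_Φ ⊆ (L¹(ℙ))^N
    (∀ Z ∈ Kdual ℙ Φ, ∀ j, Integrable (fun ω => Z ω j) ℙ) ∧
    -- every Z ∈ K_Φ gives a ‖·‖_Φ-continuous functional on M^Φ with norm dualNorm Z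
    (∀ Z ∈ Kdual ℙ Φ,
      (∀ X ∈ Mspace ℙ Φ, |∫ ω, ∑ j, X ω j * Z ω j ∂ℙ| ≤ dualNorm Z * lux X) ∧
      dualNorm Z = sSup {r | ∃ X ∈ Mspace ℙ Φ, lux X ≤ 1 ∧
        r = |∫ ω, ∑ j, X ω j * Z ω j ∂ℙ|}) ∧
    -- every ‖·‖_Φ-continuous linear functional on M^Φ is represented by some Z ∈ K_Φ
    (∀ T : (Ω → Fin N → ℝ) → ℝ,
      (∀ X ∈ Mspace ℙ Φ, ∀ X' ∈ Mspace ℙ Φ, T (X + X') = T X + T X') →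
      (∀ X ∈ Mspace ℙ Φ, ∀ c : ℝ, T (c • X) = c * T X) →
      (∃ C : ℝ, ∀ X ∈ Mspace ℙ Φ, |T X| ≤ C * lux X) →
      ∃ Z ∈ Kdual ℙ Φ,
        (∀ X ∈ Mspace ℙ Φ, T X = ∫ ω, ∑ j, X ω j * Z ω j ∂ℙ) ∧
        dualNorm Z = sSup {r | ∃ X ∈ Mspace ℙ Φ, lux X ≤ 1 ∧ r = |T X|}) := by
  intro _ _
  refine ⟨?_, fun Z hZ => integrable_apply_of_heart hΦ (Kdual.integrable_heart hZ),
    fun Z hZ => ⟨fun X hX => abs_integral_le_dualNorm_mul_lux hΦ hZ hX,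
      dualNorm_eq_sSup_heart hΦ hZ⟩, ?_⟩
  · ext Z
    exact ⟨fun hZ => ⟨hZ.1, Kdual.integrable_heart hZ⟩, fun hZ => mem_Kdual_of_heart hΦ hZ.1 hZ.2⟩
  · rintro T hadd hsmul ⟨C, hC⟩
    let S : heart ℙ hΦ →ₗ[ℝ] ℝ :=
      { toFun := fun X => T X
        map_add' := fun X Y => hadd X X.2 Y Y.2
        map_smul' := fun c X => hsmul X X.2 c }
    obtain ⟨T', hT'⟩ := S.exists_extend
    have hTT : ∀ X ∈ Mspace ℙ Φ, T' X = T X := fun X hX => LinearMap.congr_fun hT' ⟨X, hX⟩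
    obtain ⟨Z, hZ, hrep⟩ := exists_mem_Kdual_representing (T := T') hΦ (abs_nonneg C)
      fun X hX => by
        rw [hTT X hX]
        exact (hC X hX).trans (mul_le_mul_of_nonneg_right (le_abs_self C) lux_nonneg)
    have hTZ : ∀ X ∈ Mspace ℙ Φ, T X = ∫ ω, ∑ j, X ω j * Z ω j ∂ℙ := fun X hX =>
      (hTT X hX).symm.trans (hrep X hX)
    refine ⟨Z, hZ, hTZ, (dualNorm_eq_sSup_heart hΦ hZ).trans (congrArg sSup ?_)⟩
    ext r
    refine exists_congr fun X => and_congr_right fun hX => ?_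
    rw [hTZ X hX]
    rfl

end MSORTE
end
end
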